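/- arXiv:2507.17181 — 13 statements merged into one kernel-verified Lean document; each statement's English description precedes it below -/
import Mathlib

section
/- Let h = max{|l₁|,…,|lₙ|}. For every integer k > 0, the number of tuples i ∈ ℕⁿ with |i| = k for which there exist 1 ≤ j ≤ n and π ∈ Σₙ with i_j − l_{π(j)} < 0 is at most n·(h+1)·k^{n−2}. -/
lemma aux_succ (s d : ℕ) : (s + (d+1)).choose (d+1) * (d+1) = (s+d+1) * (s+d).choose d := by
  have := Nat.add_one_mul_choose_eq (s+d) d
  rw [← add_assoc]
  exact this.symm

lemma aux1 (s d : ℕ) : (s + d).choose d ≤ (s+1)^d := by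
  induction d with
  | zero => simp
  | succ d ih =>
    have h := aux_succ s d
    have : (s+d+1) * (s+d).choose d ≤ ((s+1) * (d+1)) * (s+1)^d :=
      Nat.mul_le_mul (by nlinarith [Nat.zero_le (s*d)]) ih
    rw [← h] at this
    refine Nat.le_of_mul_le_mul_right (c := d+1) ?_ (by omega)
    calc _ ≤ _ := this
      _ = _ := by ring

lemma aux2 (k d : ℕ) (hk : 2 ≤ k) : (k + d).choose d ≤ 2 * k^d := by
  induction d with
  | zero => simp
  | succ d ih =>
    rcases Nat.eq_zero_or_pos d with rfl | hd
    · simp; omega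
    have h := aux_succ k d
    have : (k+d+1) * (k+d).choose d ≤ (k * (d+1)) * (2 * k^d) :=
      Nat.mul_le_mul (by nlinarith) ih
    rw [← h] at this
    refine Nat.le_of_mul_le_mul_right (c := d+1) ?_ (by omega)
    calc _ ≤ _ := this
      _ = _ := by ring

lemma card_tot (d s : ℕ) : (Finset.piAntidiag (Finset.univ : Finset (Fin (d+1))) s).card
    = (s + d).choose d := by
  have e : (Finset.piAntidiag (Finset.univ : Finset (Fin (d+1))) s) ≃
      {P : Fin (d+1) → ℕ // ∑ i, P i = s} := Equiv.subtypeEquivRight (fun f => by simp)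
  rw [← Fintype.card_coe, Fintype.card_congr (e.trans (Sym.equivNatSumOfFintype _ s).symm),
    Sym.card_sym_eq_choose, Fintype.card_fin]
  rw [show d + 1 + s - 1 = s + d by omega]
  exact Nat.choose_symm_add

lemma card_fib (d k m : ℕ) (j : Fin (d+2)) :
    ((Finset.piAntidiag (Finset.univ : Finset (Fin (d+2))) k).filter (fun i => i j = m)).card
    ≤ if m ≤ k then (k - m + d).choose d else 0 := by
  split_ifs with hm
  · rw [← card_tot]
    apply Finset.card_le_card_of_injOn (fun i => j.removeNth i)
    · intro i hi
      simp only [Finset.coe_filter, Finset.mem_piAntidiag, Set.mem_ofPred_eq] at hi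
      obtain ⟨⟨h1, -⟩, h2⟩ := hi
      rw [Fin.sum_univ_succAbove _ j] at h1
      simp only [Finset.mem_coe, Finset.mem_piAntidiag, Fin.removeNth]
      refine ⟨?_, by simp⟩
      change ∑ x, i (j.succAbove x) = k - m
      omega
    · intro a ha b hb hab
      simp only [Finset.coe_filter, Set.mem_ofPred_eq] at ha hb
      rw [← Fin.insertNth_self_removeNth j a, ← Fin.insertNth_self_removeNth j b, ha.2, hb.2]
      simp only at hab
      rw [hab]
  · rw [Nat.le_zero, Finset.card_eq_zero, Finset.filter_eq_empty_iff]
    intro i hi h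
    simp only [Finset.mem_piAntidiag] at hi
    have h0 : ∑ x, i x = k := hi.1
    have := Finset.single_le_sum (f := i) (fun _ _ => Nat.zero_le _) (Finset.mem_univ j)
    omega

lemma sum_bd (d k h : ℕ) (hk : 2 ≤ k) :
    ∑ m ∈ Finset.range h, (if m ≤ k then (k - m + d).choose d else 0) ≤ (h+1) * k^d := by
  induction h with
  | zero => simp
  | succ h ih =>
    rcases Nat.eq_zero_or_pos h with rfl | hh
    · simpa using aux2 k d hk
    rw [Finset.sum_range_succ, add_mul (h+1) 1, one_mul]
    refine Nat.add_le_add ih ?_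
    split_ifs with hm
    · exact (aux1 _ _).trans (Nat.pow_le_pow_left (by omega) _)
    · exact Nat.zero_le _

/-- Let `h = max{|l₁|,…,|lₙ|}`.  For every `k > 0`, the number of tuples `i ∈ ℕⁿ`
with `|i| = k` for which there exist `j` and a permutation `π` with
`i_j − l_{π(j)} < 0` is at most `n·(h+1)·k^(n−2)`. -/
theorem statement1 {n : ℕ} (hn : 2 ≤ n) (l : Fin n → ℤ) (k : ℕ) (hk : 0 < k) :
    Set.ncard {i : Fin n → ℕ | (∑ a, i a) = k ∧
        ∃ j : Fin n, ∃ π : Equiv.Perm (Fin n), (i j : ℤ) - l (π j) < 0} ≤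
      n * (Finset.univ.sup (fun a => (l a).natAbs) + 1) * k ^ (n - 2) := by
  obtain ⟨d, rfl⟩ : ∃ d, n = d + 2 := ⟨n - 2, by omega⟩
  set h := Finset.univ.sup (fun a => (l a).natAbs) with hh
  rw [Nat.add_sub_cancel]
  rcases Nat.lt_or_ge k 2 with hk2 | hk2
  · obtain rfl : k = 1 := by omega
    refine (Set.ncard_le_ncard (t := ((Finset.piAntidiag Finset.univ 1 : Finset (Fin (d+2) → ℕ)) : Set (Fin (d+2) → ℕ))) ?_ (Finset.finite_toSet _)).trans ?_
    · intro i hi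
      simp only [Finset.mem_coe, Finset.mem_piAntidiag]
      exact ⟨hi.1, by simp⟩
    · rw [Set.ncard_coe_finset, card_tot, add_comm 1, Nat.choose_succ_self_right]
      simp only [one_pow, mul_one]
      nlinarith [Nat.zero_le ((d+2)*h)]
  · refine (Set.ncard_le_ncard (t := ((Finset.univ.biUnion fun j : Fin (d+2) => (Finset.range h).biUnion fun m => (Finset.piAntidiag (Finset.univ : Finset (Fin (d+2))) k).filter (fun i => i j = m) : Finset (Fin (d+2) → ℕ)) : Set (Fin (d+2) → ℕ))) ?_ (Finset.finite_toSet _)).trans ?_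
    · rintro i ⟨h1, j, π, h2⟩
      have h3 : (l (π j)).natAbs ≤ h :=
        Finset.le_sup (f := fun a => (l a).natAbs) (Finset.mem_univ (π j))
      simp only [Finset.mem_coe, Finset.mem_biUnion, Finset.mem_filter, Finset.mem_piAntidiag]
      exact ⟨j, Finset.mem_univ _, i j, Finset.mem_range.2 (by omega), ⟨h1, by simp⟩, rfl⟩
    · rw [Set.ncard_coe_finset, mul_assoc]
      refine (Finset.card_biUnion_le_card_mul _ _ ((h+1) * k^d) ?_).trans (by simp)
      intro j _
      refine Finset.card_biUnion_le.trans ((Finset.sum_le_sum fun m _ => card_fib d k m j).trans (sum_bd d k h hk2))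
end

section
/- Suppose l₁,…,lₙ are not all equal. Let i ∈ ℕⁿ be such that i_j − l_{π(j)} ≥ 0 for all 1 ≤ j ≤ n and all π ∈ Σₙ, and such that #R_i < 𝓜. Then there exist σ, τ ∈ Σₙ with l_σ ≠ l_τ (as tuples) such that ⟨i − l_σ⟩ = ⟨i − l_τ⟩, where i − l_σ is the componentwise difference. -/
/-- `⟨i⟩`: the multiset of coordinates of an integer tuple `i`. -/
def cls {n : ℕ} (i : Fin n → ℤ) : Multiset ℤ :=
  Multiset.map i Finset.univ.val

-- `𝓜`: the number of distinct rearrangements `l_π` of the tuple `l`.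
open Classical in
noncomputable def Mcount {n : ℕ} (l : Fin n → ℤ) : ℕ :=
  (Finset.univ.image fun π : Equiv.Perm (Fin n) => l ∘ π).card

/-- `R_i = {⟨j⟩ : j ∈ ℕⁿ, ∃ π ∈ Σₙ, ⟨j + l_π⟩ = ⟨i⟩}`. -/
def Rset {n : ℕ} (l : Fin n → ℤ) (i : Fin n → ℕ) : Set (Multiset ℤ) :=
  {m | ∃ j : Fin n → ℕ, m = cls (fun a => (j a : ℤ)) ∧
        ∃ π : Equiv.Perm (Fin n),
          cls (fun a => (j a : ℤ) + l (π a)) = cls (fun a => (i a : ℤ))}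

/-- Suppose `l₁,…,lₙ` are not all equal.  If `i ∈ ℕⁿ` satisfies
`i_j − l_{π(j)} ≥ 0` for all `j` and all `π ∈ Σₙ`, and `#R_i < 𝓜`, then there exist
`σ, τ ∈ Σₙ` with `l_σ ≠ l_τ` and `⟨i − l_σ⟩ = ⟨i − l_τ⟩`. -/
theorem statement2 {n : ℕ} (hn : 2 ≤ n) (l : Fin n → ℤ)
    (hl : ¬ ∀ a b : Fin n, l a = l b)
    (i : Fin n → ℕ)
    (hpos : ∀ (j : Fin n) (π : Equiv.Perm (Fin n)), 0 ≤ (i j : ℤ) - l (π j))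
    (hR : Set.ncard (Rset l i) < Mcount l) :
    ∃ σ τ : Equiv.Perm (Fin n), l ∘ σ ≠ l ∘ τ ∧
      cls (fun a => (i a : ℤ) - l (σ a)) = cls (fun a => (i a : ℤ) - l (τ a)) := by
  classical
  have key : ∀ (f g : Fin n → ℤ), cls f = cls g → ∃ ρ : Equiv.Perm (Fin n), f = g ∘ ρ := by
    intro f g h
    have hc : ∀ c : ℤ, Fintype.card {a // f a = c} = Fintype.card {a // g a = c} := by
      intro c
      have h1 := congrArg (Multiset.count c) h
      simp only [cls, Multiset.count_map] at h1
      rw [Fintype.card_subtype, Fintype.card_subtype, Finset.card_def, Finset.card_def,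
        Finset.filter_val, Finset.filter_val]
      simpa only [eq_comm] using h1
    refine ⟨Equiv.ofFiberEquiv (f := f) (g := g) fun c => Fintype.equivOfCardEq (hc c), ?_⟩
    funext a
    exact (Equiv.ofFiberEquiv_map _ a).symm
  have key2 : ∀ (f : Fin n → ℤ) (ρ : Equiv.Perm (Fin n)), cls (f ∘ ρ) = cls f := by
    intro f ρ
    unfold cls
    rw [← Multiset.map_map, Multiset.map_univ_val_equiv]
  have hfin : (Rset l i).Finite := by
    refine (Set.finite_range (fun σ : Equiv.Perm (Fin n) =>
      cls (fun a => (i a : ℤ) - l (σ a)))).subset ?_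
    rintro m ⟨j, rfl, π, h⟩
    obtain ⟨ρ, hρ⟩ := key _ _ h.symm
    refine ⟨ρ.trans π, ?_⟩
    rw [← key2 (fun a => (j a : ℤ)) ρ]
    simp only
    congr 1
    funext a
    have := congrFun hρ a
    simp only [Function.comp] at this
    simp [this]
  by_contra! hcon
  refine absurd hR (not_lt.2 ?_)
  unfold Mcount
  rw [← Set.ncard_coe_finset]
  refine Set.ncard_le_ncard_of_injOn (fun f => cls (fun a => (i a : ℤ) - f a)) ?_ ?_ hfin
  · intro f hf
    simp only [Finset.coe_image, Finset.coe_univ, Set.image_univ, Set.mem_range] at hf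
    obtain ⟨σ, rfl⟩ := hf
    refine ⟨fun a => ((i a : ℤ) - l (σ a)).toNat, ?_, σ, ?_⟩
    · congr 1
      funext a
      rw [Int.toNat_of_nonneg (hpos a σ)]
      rfl
    · congr 1
      funext a
      rw [Int.toNat_of_nonneg (hpos a σ)]
      ring
  · intro f hf g hg h
    simp only [Finset.coe_image, Finset.coe_univ, Set.image_univ, Set.mem_range] at hf hg
    obtain ⟨σ, rfl⟩ := hf
    obtain ⟨τ, rfl⟩ := hg
    by_contra hne
    exact hcon σ τ hne h
end

section
/- Suppose l₁,…,lₙ are not all equal. For every integer k > 0, the number of tuples i ∈ ℕⁿ with |i| = k such that i_j − l_{π(j)} ≥ 0 for all 1 ≤ j ≤ n and all π ∈ Σₙ and such that #R_i < 𝓜 is at most (n!)²·n²·k^{n−2}. -/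
lemma cls_eq_perm {n : ℕ} {f g : Fin n → ℤ} (h : cls f = cls g) :
    ∃ σ : Equiv.Perm (Fin n), f = g ∘ σ := by
  classical
  have hc : ∀ c : ℤ, Nonempty ({a // f a = c} ≃ {b // g b = c}) := by
    intro c
    refine ⟨Fintype.equivOfCardEq ?_⟩
    have h1 := congrArg (Multiset.count c) h
    unfold cls at h1
    rw [Multiset.count_map, Multiset.count_map] at h1
    rw [Fintype.card_subtype, Fintype.card_subtype, Finset.card_def, Finset.card_def,
      Finset.filter_val, Finset.filter_val]
    simpa only [eq_comm] using h1
  refine ⟨Equiv.ofFiberEquiv (fun c => (hc c).some), ?_⟩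
  funext a
  exact (Equiv.ofFiberEquiv_map _ a).symm

lemma Rset_finite {n : ℕ} (l : Fin n → ℤ) (i : Fin n → ℕ) : (Rset l i).Finite := by
  apply Set.Finite.subset (Set.finite_range
    (fun p : Equiv.Perm (Fin n) × Equiv.Perm (Fin n) =>
      cls (fun a => (i (p.1 a) : ℤ) - l (p.2 a))))
  rintro m ⟨j, rfl, π, h⟩
  obtain ⟨τ, hτ⟩ := cls_eq_perm h
  refine ⟨(τ, π), ?_⟩
  show cls _ = cls _
  congr 1
  funext a
  have := congrFun hτ a
  simp only [Function.comp] at this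
  simp only
  omega

lemma bad_mem {n : ℕ} (l : Fin n → ℤ) (i : Fin n → ℕ)
    (h0 : ∀ (j : Fin n) (π : Equiv.Perm (Fin n)), 0 ≤ (i j : ℤ) - l (π j))
    (h : Set.ncard (Rset l i) < Mcount l) :
    ∃ a b p q : Fin n, a ≠ b ∧ (i a : ℤ) - i b = l p - l q := by
  classical
  have hfin := Rset_finite l i
  rw [Set.ncard_eq_toFinset_card _ hfin] at h
  unfold Mcount at h
  obtain ⟨m, hm, m', hm', hne, heq⟩ := Finset.exists_ne_map_eq_of_card_lt_of_maps_to
    (f := fun m : Fin n → ℤ => cls (fun a => (i a : ℤ) - m a)) (by convert h) (by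
      intro m hm
      simp only [Finset.coe_image, Set.mem_image, Finset.coe_univ, Set.mem_univ, true_and] at hm
      obtain ⟨π, rfl⟩ := hm
      simp only [Set.Finite.coe_toFinset]
      refine ⟨fun a => ((i a : ℤ) - l (π a)).toNat, ?_, π, ?_⟩
      · congr 1
        funext a
        have := h0 a π
        simp only [Function.comp]
        omega
      · congr 1
        funext a
        have := h0 a π
        beta_reduce
        omega)
  simp only [Finset.mem_image, Finset.mem_univ, true_and] at hm hm'
  obtain ⟨π, rfl⟩ := hm
  obtain ⟨π', rfl⟩ := hm'
  obtain ⟨σ, hσ⟩ := cls_eq_perm heq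
  have hs : ∃ a, a ≠ σ a := by
    by_contra! hc
    apply hne
    funext a
    have := congrFun hσ a
    simp only [Function.comp, ← hc a] at this ⊢
    omega
  obtain ⟨a, ha⟩ := hs
  refine ⟨a, σ a, π a, π' (σ a), ha, ?_⟩
  have := congrFun hσ a
  simp only [Function.comp] at this
  omega

lemma hyper_card {n : ℕ} (k : ℕ) (a b : Fin n) (hab : a ≠ b) (c : ℤ) :
    {i : Fin n → ℕ | (∑ x, i x) = k ∧ (i a : ℤ) - i b = c}.ncard ≤ (k + 1) ^ (n - 2) := by
  classical
  set s : Finset (Fin n) := (Finset.univ.erase a).erase b with hs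
  have hsc : s.card = n - 2 := by
    rw [hs, Finset.card_erase_of_mem (by simp [hab.symm]), Finset.card_erase_of_mem (by simp)]
    simp; omega
  have hsum : ∀ i : Fin n → ℕ, ∑ x, i x = i a + (i b + ∑ x ∈ s, i x) := by
    intro i
    rw [hs, Finset.add_sum_erase _ _ (by simp [hab.symm]), Finset.add_sum_erase _ _ (by simp)]
  have key := Set.ncard_le_ncard_of_injOn
    (s := {i : Fin n → ℕ | (∑ x, i x) = k ∧ (i a : ℤ) - i b = c})
    (t := ((Fintype.piFinset (fun _ : s => Finset.range (k + 1)) : Finset (s → ℕ)) : Set (s → ℕ)))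
    (fun i x => i x) (by
      rintro i ⟨h1, -⟩
      simp only [Finset.mem_coe, Fintype.mem_piFinset, Finset.mem_range]
      intro x
      have := Finset.single_le_sum (f := i) (fun _ _ => Nat.zero_le _) (Finset.mem_univ x.1)
      omega) (by
      rintro i ⟨h1, h2⟩ j ⟨h3, h4⟩ hij
      have hx : ∀ x ∈ s, i x = j x := fun x hx => congrFun hij ⟨x, hx⟩
      replace h2 : (i a : ℤ) - i b = c := h2
      replace h4 : (j a : ℤ) - j b = c := h4
      replace h1 : ∑ x, i x = k := h1
      replace h3 : ∑ x, j x = k := h3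
      have h5 := hsum i
      have h6 := hsum j
      have h7 : ∑ x ∈ s, i x = ∑ x ∈ s, j x := Finset.sum_congr rfl hx
      funext x
      by_cases hxa : x = a
      · subst hxa; omega
      by_cases hxb : x = b
      · subst hxb; omega
      exact hx x (by simp [hs, hxa, hxb])) (Finset.finite_toSet _)
  rw [Set.ncard_coe_finset] at key
  simpa [Fintype.card_piFinset, hsc] using key

lemma arith (m : ℕ) : (m + 2) ^ 2 * 2 ^ m ≤ (Nat.factorial (m + 2)) ^ 2 := by
  induction m with
  | zero => decide
  | succ m ih =>
    rw [show m + 1 + 2 = (m + 2) + 1 by ring, Nat.factorial_succ, mul_pow]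
    apply Nat.mul_le_mul_left
    refine le_trans ?_ ih
    rw [pow_succ, mul_comm]
    have : 2 ≤ (m + 2) ^ 2 := by nlinarith [Nat.zero_le m]
    exact Nat.mul_le_mul_right _ this

/-- Suppose `l₁,…,lₙ` are not all equal.  For every `k > 0`, the number of tuples
`i ∈ ℕⁿ` with `|i| = k`, with `i_j − l_{π(j)} ≥ 0` for all `j` and all `π ∈ Σₙ`,
and with `#R_i < 𝓜`, is at most `(n!)²·n²·k^(n−2)`. -/
theorem statement3 {n : ℕ} (hn : 2 ≤ n) (l : Fin n → ℤ)
    (hl : ¬ ∀ a b : Fin n, l a = l b) (k : ℕ) (hk : 0 < k) :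
    Set.ncard {i : Fin n → ℕ | (∑ a, i a) = k ∧
        (∀ (j : Fin n) (π : Equiv.Perm (Fin n)), 0 ≤ (i j : ℤ) - l (π j)) ∧
        Set.ncard (Rset l i) < Mcount l} ≤
      (Nat.factorial n) ^ 2 * n ^ 2 * k ^ (n - 2) := by
  classical
  let H : (Fin n × Fin n) × (Fin n × Fin n) → Set (Fin n → ℕ) := fun t =>
    {i | (∑ x, i x) = k ∧ t.1.1 ≠ t.1.2 ∧ (i t.1.1 : ℤ) - i t.1.2 = l t.2.1 - l t.2.2}
  have hfin : {i : Fin n → ℕ | (∑ x, i x) = k}.Finite := by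
    apply Set.Finite.subset (Finset.finite_toSet
      (Fintype.piFinset (fun _ : Fin n => Finset.range (k + 1))))
    intro i hi
    simp only [Finset.mem_coe, Fintype.mem_piFinset, Finset.mem_range]
    intro x
    have := Finset.single_le_sum (f := i) (fun _ _ => Nat.zero_le _) (Finset.mem_univ x)
    replace hi : ∑ x, i x = k := hi
    omega
  have hH : ∀ t, (H t).ncard ≤ (k + 1) ^ (n - 2) := by
    intro t
    by_cases ht : t.1.1 = t.1.2
    · simp [H, ht]
    · refine le_trans (Set.ncard_le_ncard ?_ ?_) (hyper_card k t.1.1 t.1.2 ht (l t.2.1 - l t.2.2))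
      · rintro i ⟨h1, -, h2⟩
        exact ⟨h1, h2⟩
      · exact hfin.subset fun i hi => hi.1
  have hsub : {i : Fin n → ℕ | (∑ a, i a) = k ∧
        (∀ (j : Fin n) (π : Equiv.Perm (Fin n)), 0 ≤ (i j : ℤ) - l (π j)) ∧
        Set.ncard (Rset l i) < Mcount l} ⊆ ⋃ t ∈ (Finset.univ : Finset ((Fin n × Fin n) × (Fin n × Fin n))), H t := by
    rintro i ⟨h1, h2, h3⟩
    obtain ⟨a, b, p, q, hab, h⟩ := bad_mem l i h2 h3
    simp only [Set.mem_iUnion]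
    exact ⟨((a, b), (p, q)), Finset.mem_univ _, h1, hab, h⟩
  have hU : (⋃ t ∈ (Finset.univ : Finset ((Fin n × Fin n) × (Fin n × Fin n))), H t).Finite := by
    apply hfin.subset
    intro i hi
    simp only [Set.mem_iUnion] at hi
    obtain ⟨t, -, h⟩ := hi
    exact h.1
  have hle := Set.ncard_le_ncard hsub hU
  have h2 := Finset.set_ncard_biUnion_le (Finset.univ) H
  have h3 := Finset.sum_le_card_nsmul Finset.univ (fun t => (H t).ncard) _ (fun t _ => hH t)
  refine (hle.trans (h2.trans h3)).trans ?_
  obtain ⟨m, rfl⟩ : ∃ m, n = m + 2 := ⟨n - 2, by omega⟩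
  have e : m + 2 - 2 = m := rfl
  simp only [e, Finset.card_univ, Fintype.card_prod, Fintype.card_fin, smul_eq_mul]
  have h4 : (k + 1) ^ m ≤ 2 ^ m * k ^ m := by
    rw [← mul_pow]
    exact Nat.pow_le_pow_left (by omega) m
  calc (m + 2) * (m + 2) * ((m + 2) * (m + 2)) * (k + 1) ^ m
      ≤ (m + 2) * (m + 2) * ((m + 2) * (m + 2)) * (2 ^ m * k ^ m) := Nat.mul_le_mul_left _ h4
    _ = ((m + 2) ^ 2 * 2 ^ m) * ((m + 2) ^ 2 * k ^ m) := by ring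
    _ ≤ (Nat.factorial (m + 2)) ^ 2 * ((m + 2) ^ 2 * k ^ m) := Nat.mul_le_mul_right _ (arith m)
    _ = _ := by ring
end

section
/- Suppose l₁,…,lₙ are not all equal. If j ∈ ℕⁿ has two equal coordinates, i.e. j_s = j_t for some 1 ≤ s < t ≤ n, then #{⟨j − l_π⟩ : π ∈ Σₙ} ≤ 𝓜 − 1, where j − l_π ∈ ℤⁿ is the componentwise difference. -/
/-- Suppose `l₁,…,lₙ` are not all equal.  If `j ∈ ℕⁿ` has two equal coordinates
`j_s = j_t` with `s < t`, then `#{⟨j − l_π⟩ : π ∈ Σₙ} ≤ 𝓜 − 1`. -/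
theorem statement4 {n : ℕ} (hn : 2 ≤ n) (l : Fin n → ℤ)
    (hl : ¬ ∀ a b : Fin n, l a = l b)
    (j : Fin n → ℕ) (s t : Fin n) (hst : s < t) (heq : j s = j t) :
    Set.ncard {m : Multiset ℤ | ∃ π : Equiv.Perm (Fin n),
        m = cls (fun a => (j a : ℤ) - l (π a))} ≤ Mcount l - 1 := by
  classical
  obtain ⟨π, hπ⟩ : ∃ π : Equiv.Perm (Fin n), l (π s) ≠ l (π t) := by
    push Not at hl
    obtain ⟨a, b, hab⟩ := hl
    have hne : a ≠ b := fun h => hab (by rw [h])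
    have hac : a ≠ Equiv.swap s a t := by
      intro h
      have h2 : Equiv.swap s a s = Equiv.swap s a t := by
        rw [Equiv.swap_apply_left]; exact h
      exact hst.ne ((Equiv.swap s a).injective h2)
    refine ⟨Equiv.swap (Equiv.swap s a t) b * Equiv.swap s a, ?_⟩
    rw [Equiv.Perm.mul_apply, Equiv.Perm.mul_apply, Equiv.swap_apply_left,
      Equiv.swap_apply_left, Equiv.swap_apply_of_ne_of_ne hac hne]
    exact hab
  let S : Finset (Fin n → ℤ) := Finset.univ.image fun π : Equiv.Perm (Fin n) => l ∘ π
  let F : (Fin n → ℤ) → Multiset ℤ := fun v => cls (fun a => (j a : ℤ) - v a)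
  have hS : ∀ ρ : Equiv.Perm (Fin n), l ∘ ρ ∈ S := fun ρ =>
    Finset.mem_image_of_mem _ (Finset.mem_univ ρ)
  have hF : F (l ∘ ⇑(π * Equiv.swap s t)) = F (l ∘ π) := by
    have h1 : (fun a => (j a : ℤ) - (l ∘ ⇑(π * Equiv.swap s t)) a)
        = (fun a => (j a : ℤ) - (l ∘ π) a) ∘ Equiv.swap s t := by
      funext a
      have : j (Equiv.swap s t a) = j a := by
        rcases eq_or_ne a s with rfl | h
        · rw [Equiv.swap_apply_left, heq]
        rcases eq_or_ne a t with rfl | h'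
        · rw [Equiv.swap_apply_right, heq]
        rw [Equiv.swap_apply_of_ne_of_ne h h']
      simp [this]
    change cls _ = cls _
    rw [h1, cls, cls, ← Multiset.map_map, Multiset.map_univ_val_equiv]
  have hne : l ∘ ⇑(π * Equiv.swap s t) ≠ l ∘ π := by
    intro h
    have := congrFun h t
    simp at this
    exact hπ this
  have hsub : {m : Multiset ℤ | ∃ π : Equiv.Perm (Fin n),
        m = cls (fun a => (j a : ℤ) - l (π a))} ⊆ (((S.erase (l ∘ π)).image F : Finset _) : Set (Multiset ℤ)) := by
    rintro m ⟨ρ, rfl⟩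
    rw [Finset.mem_coe, Finset.mem_image]
    by_cases h : l ∘ ρ = l ∘ π
    · refine ⟨_, Finset.mem_erase.2 ⟨hne, hS _⟩, ?_⟩
      rw [hF, ← h]; rfl
    · exact ⟨_, Finset.mem_erase.2 ⟨h, hS _⟩, rfl⟩
  calc _ ≤ _ := Set.ncard_le_ncard hsub (Finset.finite_toSet _)
    _ = _ := Set.ncard_coe_finset _
    _ ≤ (S.erase (l ∘ π)).card := Finset.card_image_le
    _ = S.card - 1 := Finset.card_erase_of_mem (hS π)
    _ = Mcount l - 1 := by unfold Mcount; congr!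
end

section
/- Suppose l₁,…,lₙ are not all equal. If j ∈ ℕⁿ satisfies #R_j = 𝓜, then the coordinates j₁,…,jₙ are pairwise distinct. -/
theorem cls_exists {n : ℕ} (f g : Fin n → ℤ) (h : cls f = cls g) :
    ∃ σ : Equiv.Perm (Fin n), f = g ∘ σ := by
  have hc : ∀ c : ℤ, Nonempty ({a // f a = c} ≃ {b // g b = c}) := by
    intro c
    rw [← Fintype.card_eq, Fintype.card_subtype, Fintype.card_subtype]
    have := congrArg (Multiset.count c) h
    simp only [cls, Multiset.count_map] at this
    simp only [Finset.card_def, Finset.filter_val, eq_comm (b := c)]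
    exact this
  let e := fun c => Classical.choice (hc c)
  exact ⟨Equiv.ofFiberEquiv e, funext fun x => (Equiv.ofFiberEquiv_map e x).symm⟩

theorem cls_comp {n : ℕ} (f : Fin n → ℤ) (σ : Equiv.Perm (Fin n)) : cls (f ∘ σ) = cls f :=
  by rw [cls, ← Multiset.map_map, Multiset.map_univ_val_equiv, cls]

/-- Suppose `l₁,…,lₙ` are not all equal.  If `j ∈ ℕⁿ` satisfies `#R_j = 𝓜`,
then the coordinates of `j` are pairwise distinct. -/
theorem statement5 {n : ℕ} (hn : 2 ≤ n) (l : Fin n → ℤ)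
    (hl : ¬ ∀ a b : Fin n, l a = l b)
    (j : Fin n → ℕ) (hR : Set.ncard (Rset l j) = Mcount l) :
    Function.Injective j := by
  classical
  intro a b hab
  by_contra hne
  push Not at hl
  obtain ⟨c, d, hcd⟩ := hl
  set S : Finset (Fin n → ℤ) := Finset.univ.image fun π : Equiv.Perm (Fin n) => l ∘ π with hS
  have hM : Mcount l = S.card := by
    unfold Mcount
    rw [hS]
  let F : (Fin n → ℤ) → Multiset ℤ := fun f => cls (fun x => (j x : ℤ) - f x)
  have hsub : Rset l j ⊆ ((S.image F : Finset (Multiset ℤ)) : Set (Multiset ℤ)) := by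
    rintro m ⟨k, rfl, π, h⟩
    obtain ⟨σ, hσ⟩ := cls_exists _ _ h.symm
    rw [Finset.mem_coe, Finset.mem_image]
    refine ⟨l ∘ (σ.trans π), Finset.mem_image.2 ⟨σ.trans π, Finset.mem_univ _, rfl⟩, ?_⟩
    rw [← cls_comp (fun a => (k a : ℤ)) σ]
    show cls _ = cls _
    congr 1
    funext x
    have := congrFun hσ x
    simp at this ⊢
    omega
  have hle : S.card ≤ (S.image F).card := by
    rw [← hM, ← hR, ← Set.ncard_coe_finset]
    exact Set.ncard_le_ncard hsub (Finset.finite_toSet _)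
  have hinj : Set.InjOn F S :=
    Finset.card_image_iff.1 (le_antisymm Finset.card_image_le hle)
  let π : Equiv.Perm (Fin n) := (Equiv.swap a c).trans (Equiv.swap (Equiv.swap a c b) d)
  have hcd' : c ≠ d := fun h => hcd (by rw [h])
  have hcb : c ≠ Equiv.swap a c b := by
    intro h
    have h2 : Equiv.swap a c a = Equiv.swap a c b := by rw [Equiv.swap_apply_left]; exact h
    exact hne ((Equiv.swap a c).injective h2)
  have hπa : π a = c := by
    simp only [π, Equiv.trans_apply, Equiv.swap_apply_left]
    exact Equiv.swap_apply_of_ne_of_ne hcb hcd'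
  have hπb : π b = d := by
    simp only [π, Equiv.trans_apply, Equiv.swap_apply_left]
  have hj : ∀ x, j (Equiv.swap a b x) = j x := by
    intro x
    rw [Equiv.swap_apply_def]
    split_ifs with h1 h2
    · rw [h1, hab]
    · rw [h2, hab]
    · rfl
  have hF : F (l ∘ ((Equiv.swap a b).trans π)) = F (l ∘ π) := by
    show cls _ = cls _
    rw [← cls_comp (fun x => (j x : ℤ) - (l ∘ π) x) (Equiv.swap a b)]
    congr 1
    funext x
    simp [hj]
  have key := hinj (Finset.mem_coe.2 (Finset.mem_image.2 ⟨_, Finset.mem_univ _, rfl⟩))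
    (Finset.mem_coe.2 (Finset.mem_image.2 ⟨_, Finset.mem_univ _, rfl⟩)) hF
  have := congrFun key a
  simp only [Function.comp_apply, Equiv.trans_apply, Equiv.swap_apply_left, hπa, hπb] at this
  exact hcd this.symm
end

section
/- Let i, j ∈ ℕⁿ. Suppose the coordinates j₁,…,jₙ are pairwise distinct and N_{j,i} ≠ ∅. Let t₁,…,t_s be the multiplicities of the distinct values occurring among i₁,…,iₙ, and let n₁,…,n_k be the multiplicities of the distinct values occurring among l₁,…,lₙ. Then #N_{j,i} ≥ t₁!·t₂!⋯t_s! · n₁!·n₂!⋯n_k!. -/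
/-- `N_{j,i} = {π ∈ Σₙ : ⟨i + l_π⟩ = ⟨j⟩}` (as a set of permutations). -/
def Nset {n : ℕ} (l : Fin n → ℤ) (j i : Fin n → ℕ) : Set (Equiv.Perm (Fin n)) :=
  {π | cls (fun a => (i a : ℤ) + l (π a)) = cls (fun a => (j a : ℤ))}

theorem aux_card {n : ℕ} {β : Type*} [DecidableEq β] (f : Fin n → β) :
    Fintype.card {g : Equiv.Perm (Fin n) // f ∘ g = f} =
      ∏ v ∈ Finset.univ.image f,
        Nat.factorial (Finset.univ.filter fun a => f a = v).card := by
  rw [DomMulAct.stabilizer_card']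
  refine Finset.prod_congr rfl fun v _ => ?_
  simp [Fintype.card_subtype]

theorem aux_inj {n : ℕ} (f : Fin n → ℤ) (j : Fin n → ℕ) (hj : Function.Injective j)
    (h : cls f = cls (fun a => (j a : ℤ))) : Function.Injective f := by
  have h1 : (cls (fun a => (j a : ℤ))).Nodup :=
    Multiset.Nodup.map (fun a b hab => hj (by exact_mod_cast hab)) Finset.univ.nodup
  rw [← h] at h1
  intro a b hab
  exact Multiset.inj_on_of_nodup_map h1 a (Finset.mem_univ a) b (Finset.mem_univ b) hab

theorem aux_perm {n : ℕ} (f : Fin n → ℤ) (s : Equiv.Perm (Fin n)) :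
    cls (fun a => f (s a)) = cls f := by
  unfold cls
  have : (Finset.univ.val.map s : Multiset (Fin n)) = Finset.univ.val := by
    have := congrArg Finset.val (Finset.map_univ_equiv s)
    simpa using this
  conv_rhs => rw [← this]
  rw [Multiset.map_map]
  rfl

/-- Let `i, j ∈ ℕⁿ`, suppose the coordinates of `j` are pairwise distinct and
`N_{j,i} ≠ ∅`.  With `t₁,…,t_s` the multiplicities of the distinct values among the
`i_a` and `n₁,…,n_k` the multiplicities of the distinct values among the `l_a`, one has
`#N_{j,i} ≥ t₁!⋯t_s!·n₁!⋯n_k!`. -/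
theorem statement6 {n : ℕ} (hn : 2 ≤ n) (l : Fin n → ℤ) (i j : Fin n → ℕ)
    (hj : Function.Injective j)
    (hne : (Nset l j i).Nonempty) :
    (∏ v ∈ Finset.univ.image i,
        Nat.factorial (Finset.univ.filter fun a => i a = v).card) *
      (∏ v ∈ Finset.univ.image l,
        Nat.factorial (Finset.univ.filter fun a => l a = v).card) ≤
    Set.ncard (Nset l j i) := by
  obtain ⟨p, hp⟩ := hne
  have hp' : cls (fun a => (i a : ℤ) + l (p a)) = cls (fun a => (j a : ℤ)) := hp
  have hinj := aux_inj _ j hj hp'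
  rw [← aux_card i, ← aux_card l, ← Fintype.card_prod, ← Nat.card_eq_fintype_card,
    ← Nat.card_coe_set_eq]
  have hmem : ∀ x : {g : Equiv.Perm (Fin n) // i ∘ g = i} ×
      {g : Equiv.Perm (Fin n) // l ∘ g = l},
      x.2.1 * p * x.1.1 ∈ Nset l j i := by
    rintro ⟨⟨s, hs⟩, ⟨t, ht⟩⟩
    change cls (fun a => (i a : ℤ) + l (t (p (s a)))) = _
    rw [← hp', ← aux_perm (fun a => (i a : ℤ) + l (p a)) s]
    congr 1
    funext a
    have h1 := congrFun hs a
    have h2 := congrFun ht (p (s a))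
    simp only [Function.comp] at h1 h2
    simp only [h1, h2]
  refine Nat.card_le_card_of_injective (fun x => (⟨_, hmem x⟩ : Nset l j i)) ?_
  rintro ⟨⟨s, hs⟩, ⟨t, ht⟩⟩ ⟨⟨s', hs'⟩, ⟨t', ht'⟩⟩ h
  have h0 : t * p * s = t' * p * s' := congrArg Subtype.val h
  have hss : s = s' := by
    ext1 a
    apply hinj
    have e := congrArg l (congrArg (fun g : Equiv.Perm (Fin n) => g a) h0)
    have h1 := congrFun hs a
    have h2 := congrFun hs' a
    have h3 := congrFun ht (p (s a))
    have h4 := congrFun ht' (p (s' a))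
    simp only [Function.comp, Equiv.Perm.mul_apply] at e h1 h2 h3 h4
    simp only
    rw [h1, h2, ← h3, ← h4, e]
  subst hss
  have htt : t = t' := mul_right_cancel (mul_right_cancel h0)
  subst htt
  rfl
end

section
/- For every fixed integer n ≥ 1, the limit lim_{k→∞} P(k,n)/P(k+1,n) = 1 holds. -/
/-- `P(k,n)`: the number of partitions of `k` into at most `n` parts, realized as the
number of multisets of at most `n` positive integers whose sum is `k`. -/
noncomputable def P (k n : ℕ) : ℕ :=
  Set.ncard {m : Multiset ℕ | Multiset.card m ≤ n ∧ (∀ x ∈ m, 0 < x) ∧ m.sum = k}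

theorem finS (k n : ℕ) :
    {m : Multiset ℕ | Multiset.card m ≤ n ∧ (∀ x ∈ m, 0 < x) ∧ m.sum = k}.Finite := by
  apply (Set.finite_range (fun p : Nat.Partition k => p.parts)).subset
  rintro m ⟨_, h2, h3⟩
  exact ⟨⟨m, fun {i} hi => h2 i hi, h3⟩, rfl⟩

def phi (n : ℕ) (m : Multiset ℕ) : Multiset ℕ :=
  (m + Multiset.replicate (n - Multiset.card m) 0).map Nat.succ

theorem sum_map_succ' (m : Multiset ℕ) : (m.map Nat.succ).sum = m.sum + Multiset.card m := by
  induction m using Multiset.induction_on with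
  | empty => simp
  | cons a s ih => simp [ih]; omega

theorem sum_filter_pos (m : Multiset ℕ) : (m.filter (0 < ·)).sum = m.sum := by
  induction m using Multiset.induction_on with
  | empty => simp
  | cons a s ih =>
    rcases Nat.eq_zero_or_pos a with h | h
    · subst h; simpa using ih
    · rw [Multiset.filter_cons_of_pos (p := (0 < ·)) _ h]; simp [ih]

theorem filter_add_rep (m : Multiset ℕ) : m.filter (0 < ·) +
    Multiset.replicate (Multiset.card m - Multiset.card (m.filter (0 < ·))) 0 = m := by
  have h := Multiset.filter_add_not (0 < ·) m
  have h2 : m.filter (fun x => ¬ 0 < x) = 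
      Multiset.replicate (Multiset.card (m.filter (fun x => ¬ 0 < x))) 0 := by
    rw [Multiset.eq_replicate]
    refine ⟨rfl, fun b hb => ?_⟩
    have := (Multiset.mem_filter.1 hb).2
    omega
  have h3 := congrArg Multiset.card h
  rw [Multiset.card_add] at h3
  conv_rhs => rw [← h, h2]
  congr 2
  omega

theorem P_rec (k n : ℕ) : P (k + (n + 1)) (n + 1) = P (k + (n + 1)) n + P k (n + 1) := by
  unfold P
  have hinj : Set.InjOn (phi (n+1))
      {m : Multiset ℕ | Multiset.card m ≤ n + 1 ∧ (∀ x ∈ m, 0 < x) ∧ m.sum = k} := by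
    rintro a ⟨_, ha, _⟩ b ⟨_, hb, _⟩ hab
    have h := Multiset.map_injective Nat.succ_injective hab
    have key : ∀ (c : Multiset ℕ) (j : ℕ), (∀ x ∈ c, 0 < x) →
        (c + Multiset.replicate j 0).filter (0 < ·) = c := by
      intro c j hc
      rw [Multiset.filter_add, Multiset.filter_eq_self.2 hc, Multiset.filter_eq_nil.2, add_zero]
      intro x hx
      have := Multiset.eq_of_mem_replicate hx
      omega
    rw [← key a _ ha, h, key b _ hb]
  rw [← Set.ncard_image_of_injOn hinj, ← Set.ncard_union_eq _ (finS _ _) ((finS _ _).image _)]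
  · congr 1
    ext m
    simp only [Set.mem_union, Set.mem_image, Set.mem_setOf_eq]
    constructor
    · rintro ⟨h1, h2, h3⟩
      rcases Nat.lt_or_ge n (Multiset.card m) with h | h
      · right
        have hm : (m.map Nat.pred).map Nat.succ = m := by
          rw [Multiset.map_map]
          conv_rhs => rw [← Multiset.map_id m]
          apply Multiset.map_congr rfl
          intro x hx
          exact Nat.succ_pred_eq_of_pos (h2 x hx)
        have hs := sum_map_succ' (m.map Nat.pred)
        rw [hm, Multiset.card_map] at hs
        have hc : Multiset.card m = n + 1 := by omega
        refine ⟨(m.map Nat.pred).filter (0 < ·), ⟨?_, ?_, ?_⟩, ?_⟩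
        · refine (Multiset.card_le_card (Multiset.filter_le _ _)).trans ?_
          simp [hc]
        · intro x hx
          exact (Multiset.mem_filter.1 hx).2
        · rw [sum_filter_pos]; omega
        · have := filter_add_rep (m.map Nat.pred)
          rw [Multiset.card_map, hc] at this
          unfold phi
          rw [this, hm]
      · left; exact ⟨h, h2, h3⟩
    · rintro (⟨h1, h2, h3⟩ | ⟨a, ⟨h1, h2, h3⟩, rfl⟩)
      · exact ⟨by omega, h2, h3⟩
      · refine ⟨?_, ?_, ?_⟩
        · simp [phi]; omega
        · intro x hx
          obtain ⟨y, _, rfl⟩ := Multiset.mem_map.1 hx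
          exact Nat.succ_pos y
        · unfold phi
          rw [sum_map_succ']
          simp [h3]; omega
  · rw [Set.disjoint_left]
    rintro m ⟨h1, _, _⟩ ⟨a, ⟨h, _, _⟩, rfl⟩
    simp [phi] at h1
    omega

theorem P_pos (k n : ℕ) : 1 ≤ P k (n + 1) := by
  unfold P
  rw [Nat.succ_le_iff, Set.ncard_pos (finS _ _)]
  rcases Nat.eq_zero_or_pos k with h | h
  · exact ⟨0, by simp [h]⟩
  · exact ⟨{k}, by simp [h]⟩

theorem P_zero (k : ℕ) : P (k + 1) 0 = 0 := by
  unfold P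
  rw [Set.ncard_eq_zero (finS _ _)]
  ext m
  simp only [Set.mem_setOf_eq, Set.mem_empty_iff_false, iff_false]
  rintro ⟨h, _, h3⟩
  have : m = 0 := by simpa using h
  subst this
  simp at h3

theorem P_large (n k r : ℕ) : k ≤ P (k * (n + 2) + r) (n + 2) := by
  induction k with
  | zero => simp
  | succ k ih =>
    have h1 : P (k * (n+2) + r + (n + 2)) (n+2)
        = P (k * (n+2) + r + (n + 2)) (n+1) + P (k * (n+2) + r) (n+2) :=
      P_rec (k * (n+2) + r) (n+1)
    have h2 := P_pos (k * (n+2) + r + (n + 2)) n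
    rw [show (k + 1) * (n + 2) + r = k * (n+2) + r + (n + 2) by ring]
    omega

theorem main_bound (n : ℕ) : ∀ ε : ℝ, 0 < ε → ∃ K : ℕ, ∀ k ≥ K,
    |(P (k + 1) (n + 1) : ℝ) - P k (n + 1)| ≤ ε * P k (n + 1) := by
  induction n with
  | zero =>
    intro ε hε
    refine ⟨0, fun k _ => ?_⟩
    have h := P_rec k 0
    have h0 := P_zero k
    simp only [zero_add] at h ⊢
    rw [h, h0]
    simp
    positivity
  | succ n ih =>
    intro ε hε
    obtain ⟨K, hK⟩ := ih (ε/2) (by positivity)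
    change ∃ K : ℕ, ∀ k ≥ K, |(P (k + 1) (n + 2) : ℝ) - P k (n + 2)| ≤ ε * P k (n + 2)
    have hrec : ∀ k, (P (k + (n + 2)) (n + 2) : ℝ) = P (k + (n + 2)) (n+1) + P k (n + 2) := by
      intro k; exact_mod_cast P_rec k (n+1)
    set C : ℝ := ∑ i ∈ Finset.range (K + n + 2), |(P (i + 1) (n + 2) : ℝ) - P i (n + 2)| with hC
    have hb : ∀ k, |(P (k + 1) (n + 2) : ℝ) - P k (n + 2)| ≤ ε/2 * P k (n + 2) + C := by
      intro k
      induction k using Nat.strong_induction_on with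
      | _ k IH =>
        rcases Nat.lt_or_ge k (K + n + 2) with h | h
        · have h1 : |(P (k + 1) (n + 2) : ℝ) - P k (n + 2)| ≤ C :=
            Finset.single_le_sum (f := fun i => |(P (i + 1) (n + 2) : ℝ) - P i (n + 2)|)
              (fun i _ => abs_nonneg _) (Finset.mem_range.2 h)
          have : 0 ≤ ε/2 * P k (n + 2) := by positivity
          linarith
        · obtain ⟨j, rfl⟩ : ∃ j, k = j + (n + 2) := ⟨k - (n+2), by omega⟩
          have h1 := IH j (by omega)
          have h2 := hK (j + (n+2)) (by omega)
          have e := hrec (j+1)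
          rw [show j + 1 + (n+2) = j + (n+2) + 1 by ring] at e
          rw [e, hrec j]
          rw [abs_le] at *
          constructor <;> linarith [h1.1, h1.2, h2.1, h2.2]
    have hlarge : ∀ m r : ℕ, (m : ℝ) ≤ P (m * (n+2) + r) (n+2) := by
      intro m r; exact_mod_cast P_large n m r
    obtain ⟨M, hM⟩ := exists_nat_ge (C / (ε/2))
    refine ⟨M * (n+2), fun k hk => ?_⟩
    have h1 := hlarge M (k - M * (n+2))
    rw [Nat.add_sub_cancel' hk] at h1
    have h2 := hb k
    have h3 : C ≤ ε/2 * P k (n+2) := by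
      rw [mul_comm, ← div_le_iff₀ (by positivity)]
      linarith
    linarith

/-- For every fixed `n ≥ 1`, `lim_{k→∞} P(k,n)/P(k+1,n) = 1`. -/
theorem statement7 (n : ℕ) (hn : 1 ≤ n) :
    Filter.Tendsto (fun k : ℕ => (P k n : ℝ) / (P (k + 1) n : ℝ))
      Filter.atTop (nhds 1) := by
  obtain ⟨n, rfl⟩ : ∃ m, n = m + 1 := ⟨n - 1, by omega⟩
  have h : Filter.Tendsto (fun k : ℕ => (P (k + 1) (n+1) : ℝ) / (P k (n+1) : ℝ))
      Filter.atTop (nhds 1) := by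
    rw [Metric.tendsto_atTop]
    intro ε hε
    obtain ⟨K, hK⟩ := main_bound n (ε/2) (by positivity)
    refine ⟨K, fun k hk => ?_⟩
    have hp : (0:ℝ) < P k (n+1) := by exact_mod_cast P_pos k n
    rw [Real.dist_eq, div_sub_one hp.ne', abs_div, abs_of_pos hp, div_lt_iff₀ hp]
    have := hK k hk
    nlinarith
  have h2 := h.inv₀ one_ne_zero
  simpa using h2
end

section
/- Let α = (α_i)_{i≥0} be a complex weight that is regular with limit 1, and fix 0 < ε < 1. Then there exists a constant C > 0 such that for all sufficiently large integers k, #Ǎ_{k+S_𝔩,𝓜,ε} ≤ C·k^{n−2}. -/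
open Filter

/-- The weight extended to integer indices by `α_m = 0` for `m < 0`. -/
noncomputable def alphaE (α : ℕ → ℂ) (m : ℤ) : ℂ :=
  if 0 ≤ m then α m.toNat else 0

/-- `Γ_{i,t}`: equal to `min{|α_i|,…,|α_{i+t−1}|}` if `t > 0`, to `1` if `t = 0`,
and to `min{|α_{i−1}|,…,|α_{i+t}|}` if `t < 0`. -/
noncomputable def Gamma (α : ℕ → ℂ) (i : ℕ) (t : ℤ) : ℝ :=
  if t = 0 then 1
  else sInf {x : ℝ | ∃ s : ℕ, s < t.natAbs ∧
    x = ‖alphaE α (if 0 < t then (i : ℤ) + s else (i : ℤ) - 1 - s)‖}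

/-- `E_{r,m} = {⟨j⟩ : j ∈ ℕⁿ, |j| = r, #R_j = m}` (empty for `r < 0`). -/
def Eset {n : ℕ} (l : Fin n → ℤ) (r : ℤ) (m : ℕ) : Set (Multiset ℤ) :=
  {c | ∃ j : Fin n → ℕ, c = cls (fun a => (j a : ℤ)) ∧
        (∑ a, (j a : ℤ)) = r ∧ Set.ncard (Rset l j) = m}

/-- `Ã_{k+S_𝔩,𝓜,ε}`: the classes `⟨j⟩` in `E_{k+S_𝔩,𝓜}` such that
`Γ_{j_m, −l_{π(m)}} > 1 − ε` for all `m` and all `π ∈ Σₙ`. -/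
def Atilde {n : ℕ} (l : Fin n → ℤ) (α : ℕ → ℂ) (ε : ℝ) (k : ℤ) : Set (Multiset ℤ) :=
  {c | ∃ j : Fin n → ℕ, c = cls (fun a => (j a : ℤ)) ∧
        (∑ a, (j a : ℤ)) = k + (∑ a, l a) ∧ Set.ncard (Rset l j) = Mcount l ∧
        ∀ (m : Fin n) (π : Equiv.Perm (Fin n)), 1 - ε < Gamma α (j m) (- l (π m))}

theorem cls_cons {n : ℕ} (f : Fin (n+1) → ℤ) :
    cls f = f 0 ::ₘ cls (fun a => f a.succ) := by
  unfold cls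
  rw [Fin.univ_val_map, Fin.univ_val_map, List.ofFn_succ]
  rfl

theorem cls_perm {n : ℕ} (f : Fin n → ℤ) (σ : Equiv.Perm (Fin n)) :
    cls (fun a => f (σ a)) = cls f := by
  unfold cls
  have h : (Finset.univ : Finset (Fin n)).val.map σ = Finset.univ.val := by
    have := congrArg Finset.val (Finset.map_univ_equiv σ)
    simpa using this
  conv_rhs => rw [← h]
  rw [Multiset.map_map]
  rfl

theorem Gamma_large (α : ℕ → ℂ) (ε : ℝ) (hε0 : 0 < ε) (N0 : ℕ)
    (hN0 : ∀ i ≥ N0, 1 - ε / 2 < ‖α i‖) (i : ℕ) (t : ℤ) (hi : N0 + t.natAbs ≤ i) :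
    1 - ε < Gamma α i t := by
  unfold Gamma
  by_cases h : t = 0
  · rw [if_pos h]; linarith
  · rw [if_neg h]
    refine lt_of_lt_of_le (by linarith : 1 - ε < 1 - ε / 2) ?_
    apply le_csInf
    · exact ⟨_, 0, by omega, rfl⟩
    · rintro x ⟨s, hs, rfl⟩
      have key : ∀ z : ℤ, (N0 : ℤ) ≤ z → 1 - ε / 2 ≤ ‖alphaE α z‖ := by
        intro z hz
        unfold alphaE
        rw [if_pos (by omega)]
        exact (hN0 _ (by omega)).le
      apply key
      split_ifs <;> omega

/-- The parametrisation of multisets of size `n+2` with total `r` and smallish entry `v`. -/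
def param {n : ℕ} (r : ℤ) (N B : ℕ) (p : Fin N × (Fin n → Fin B)) : Multiset ℤ :=
  ((p.1 : ℕ) : ℤ) ::ₘ (r - ((p.1 : ℕ) : ℤ) - ∑ a, ((p.2 a : ℕ) : ℤ)) ::ₘ
    cls (fun a => ((p.2 a : ℕ) : ℤ))

theorem mem_param {n : ℕ} (r : ℤ) (N B : ℕ) (hB : r < B) (j : Fin (n+2) → ℕ)
    (hj : ∑ a, (j a : ℤ) = r) (m : Fin (n+2)) (hm : j m < N) :
    cls (fun a => (j a : ℤ)) ∈ Set.range (param (n := n) r N B) := by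
  set σ : Equiv.Perm (Fin (n+2)) := Equiv.swap 0 m
  set g : Fin (n+2) → ℕ := fun a => j (σ a)
  have hg0 : g 0 = j m := by simp [g, σ]
  have hgs : ∑ a, (g a : ℤ) = r := by
    rw [← hj]
    exact Equiv.sum_comp σ (fun a => (j a : ℤ))
  have hgB : ∀ a, g a < B := by
    intro a
    have := Finset.single_le_sum (f := fun a => (g a : ℤ)) (s := Finset.univ)
      (fun i _ => by positivity) (Finset.mem_univ a)
    omega
  refine ⟨(⟨g 0, by omega⟩, fun a => ⟨g a.succ.succ, hgB _⟩), ?_⟩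
  rw [← cls_perm (fun a => (j a : ℤ)) σ]
  change _ = cls (fun a => (g a : ℤ))
  rw [cls_cons, cls_cons]
  rw [Fin.sum_univ_succ, Fin.sum_univ_succ] at hgs
  unfold param
  simp only
  congr 2
  linarith

/-- If the weight `α` is regular with limit `1` and `0 < ε < 1`, then there is `C > 0`
such that for all sufficiently large `k`,
`#Ǎ_{k+S_𝔩,𝓜,ε} ≤ C·k^(n−2)`, where `Ǎ_{k+S_𝔩,𝓜,ε} = E_{k+S_𝔩,𝓜} ∖ Ã_{k+S_𝔩,𝓜,ε}`. -/
theorem statement9 {n : ℕ} (hn : 2 ≤ n) (l : Fin n → ℤ) (α : ℕ → ℂ)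
    (hlim : Tendsto (fun i => ‖α i‖) atTop (nhds 1))
    (hbd : ∀ m : ℕ, ‖α m‖ ≤ 1)
    (ε : ℝ) (hε0 : 0 < ε) (hε1 : ε < 1) :
    ∃ C : ℝ, 0 < C ∧ ∀ᶠ k : ℕ in atTop,
      (Set.ncard (Eset l ((k : ℤ) + ∑ a, l a) (Mcount l) \ Atilde l α ε (k : ℤ)) : ℝ) ≤
        C * (k : ℝ) ^ (n - 2) := by
  obtain ⟨n, rfl⟩ : ∃ n', n = n' + 2 := ⟨n - 2, by omega⟩
  obtain ⟨N0, hN0⟩ := eventually_atTop.1 (hlim.eventually (lt_mem_nhds (by linarith : 1 - ε / 2 < 1)))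
  set L : ℕ := ∑ a, (l a).natAbs with hL
  have hLa : ∀ a, (l a).natAbs ≤ L := fun a =>
    Finset.single_le_sum (f := fun a => (l a).natAbs) (fun _ _ => Nat.zero_le _) (Finset.mem_univ a)
  set S : ℤ := ∑ a, l a with hS
  set N := N0 + L + 1
  refine ⟨N * 2 ^ n, by positivity, ?_⟩
  filter_upwards [eventually_ge_atTop (S.natAbs + 1)] with k hk
  have hsub : (Eset l ((k : ℤ) + S) (Mcount l) \ Atilde l α ε (k : ℤ)) ⊆
      Set.range (param (n := n) ((k : ℤ) + S) N (2 * k)) := by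
    rintro c ⟨⟨j, rfl, hj, hR⟩, hc⟩
    by_contra hcon
    apply hc
    refine ⟨j, rfl, hj, hR, fun m π => ?_⟩
    apply Gamma_large α ε hε0 N0 hN0
    by_contra hlt
    apply hcon
    have := hLa (π m)
    refine mem_param _ _ _ (by push_cast; omega) j hj m ?_
    rw [Int.natAbs_neg] at hlt
    omega
  have h1 := Set.ncard_le_ncard hsub (Set.finite_range _)
  have h2 : (Set.range (param (n := n) ((k : ℤ) + S) N (2 * k))).ncard ≤ N * (2 * k) ^ n := by
    rw [← Set.image_univ]
    refine (Set.ncard_image_le Set.finite_univ).trans ?_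
    rw [Set.ncard_univ]
    simp
  have h3 : (((Eset l ((k : ℤ) + S) (Mcount l) \ Atilde l α ε (k : ℤ)).ncard : ℕ) : ℝ)
      ≤ ((N * (2 * k) ^ n : ℕ) : ℝ) := by exact_mod_cast h1.trans h2
  refine h3.trans (le_of_eq ?_)
  push_cast
  rw [mul_pow]
  ring
end

section
/- For every j′ ∈ W′ and every j ∈ 𝔚 ∖ W′, the multiset of coordinates of j′ differs from the multiset of coordinates of j; that is, there is no permutation π ∈ Σₙ with j_{π(r)} = j′_r for all 1 ≤ r ≤ n. (Consequently, in the exterior algebra of the free real vector space on ℕ with standard basis (e_m)_{m∈ℕ}, the wedge products e_{j′₁}∧⋯∧e_{j′ₙ} and e_{j₁}∧⋯∧e_{jₙ} are two nonzero vectors that are linearly independent.) -/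
/-- `W = {i ∈ ℕⁿ : d ≤ i₁ < i₂ < ⋯ < iₙ}`. -/
def Wset (n d : ℕ) : Set (Fin n → ℕ) :=
  {i | (∀ r, d ≤ i r) ∧ StrictMono i}

/-- `|𝔩| = |l₁| + ⋯ + |lₙ|`. -/
def Lnorm {n : ℕ} (l : Fin n → ℤ) : ℕ := ∑ a, (l a).natAbs

/-- `𝔚 = {i + t ∈ ℕⁿ : i ∈ W, t ∈ ℤⁿ, |t_r| ≤ |𝔩| for each r, and the coordinates
`i₁+t₁, …, iₙ+tₙ` pairwise distinct}`. -/
def Wfrak {n : ℕ} (l : Fin n → ℤ) (d : ℕ) : Set (Fin n → ℕ) :=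
  {w | ∃ i ∈ Wset n d, ∃ t : Fin n → ℤ,
        (∀ r, (t r).natAbs ≤ Lnorm l) ∧
        (∀ r, (w r : ℤ) = (i r : ℤ) + t r) ∧
        Function.Injective fun r => (i r : ℤ) + t r}

/-- `W′ = {i ∈ W : i_r − i_{r−1} > 4|𝔩| for all consecutive indices}`. -/
def Wprime {n : ℕ} (l : Fin n → ℤ) (d : ℕ) : Set (Fin n → ℕ) :=
  {i | i ∈ Wset n d ∧ ∀ a b : Fin n, (a : ℕ) + 1 = (b : ℕ) →
        i a + 4 * Lnorm l < i b}

/-- For `j′ ∈ W′` and `j ∈ 𝔚 ∖ W′`, the multiset of coordinates of `j′` differs from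
that of `j`: there is no permutation `π` with `j_{π(r)} = j′_r` for all `r`. -/
theorem statement12 {n : ℕ} (hn : 2 ≤ n) (l : Fin n → ℤ) (d : ℕ) (hd : 1 ≤ d)
    (j' j : Fin n → ℕ) (hj' : j' ∈ Wprime l d) (hj : j ∈ Wfrak l d \ Wprime l d) :
    ¬ ∃ π : Equiv.Perm (Fin n), ∀ r, j (π r) = j' r := by
  rintro ⟨π, hπ⟩
  obtain ⟨⟨i, hi, t, ht, hw, hinj⟩, hjn⟩ := hj
  have hmono' : StrictMono j' := hj'.1.2
  have gap : ∀ a b : Fin n, a < b → j' a + 4 * Lnorm l < j' b := by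
    intro a b hab
    have hab' : (a : ℕ) < b := hab
    have hlt : (a : ℕ) + 1 < n := by have := b.2; omega
    have h1 := hj'.2 a ⟨(a : ℕ) + 1, hlt⟩ rfl
    have h2 : j' ⟨(a : ℕ) + 1, hlt⟩ ≤ j' b := hmono'.monotone (by
      rw [Fin.le_def]; simpa using hab')
    omega
  have hj2 : ∀ r, j r = j' (π.symm r) := by
    intro r
    have := hπ (π.symm r)
    simpa using this
  have hsm : StrictMono j := by
    intro a b hab
    have h1 := hi.2 hab
    have h2 := ht a
    have h3 := ht b
    have h4 := hw a
    have h5 := hw b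
    rcases lt_trichotomy (π.symm a) (π.symm b) with h | h | h
    · rw [hj2 a, hj2 b]; exact hmono' h
    · exact absurd (π.symm.injective h) hab.ne
    · have h6 := gap _ _ h
      rw [← hj2 a, ← hj2 b] at h6
      omega
  have hr : Set.range j = Set.range j' := by
    have h : j' = j ∘ π := funext fun r => (hπ r).symm
    rw [h, π.surjective.range_comp]
  have heq : j = j' := (hsm.range_inj hmono').1 hr
  exact hjn (heq ▸ hj')
end

section
/- There exists a constant C₁ > 0 such that for all sufficiently large integers k, 𝔚_{(k,n)} − W′_{(k,n)} ≤ C₁·k^{n−2}; since W′ ⊆ 𝔚, this bounds the number of tuples in 𝔚 ∖ W′ with |i| = k. -/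
lemma aux_count {n : ℕ} (a b : Fin n) (hab : a ≠ b) (k M : ℕ) (g : ℕ → ℕ → ℕ)
    (S : Finset (Fin n → ℕ)) (hS : ∀ w ∈ S, (∑ r, w r) = k ∧ g (w a) (w b) < M)
    (hg : ∀ w ∈ S, ∀ w' ∈ S, g (w a) (w b) = g (w' a) (w' b) → w a + w b = w' a + w' b →
      w a = w' a ∧ w b = w' b) :
    S.card ≤ M * (k + 1) ^ (n - 2) := by
  classical
  set T : Finset (Fin n) := Finset.univ \ {a, b} with hT
  have hcard : T.card = n - 2 := by
    rw [hT, Finset.card_sdiff_of_subset (Finset.subset_univ _), Finset.card_pair hab]; simp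
  have key : S.card ≤ (Finset.range M ×ˢ
      (Fintype.piFinset (fun _ : T => Finset.range (k + 1)))).card := by
    apply Finset.card_le_card_of_injOn (fun w => (g (w a) (w b), fun s : T => w s))
    · intro w hw
      obtain ⟨h1, h2⟩ := hS w hw
      simp only [Finset.coe_product, Set.mem_prod, Finset.mem_coe, Finset.mem_range,
        Fintype.mem_piFinset]
      refine ⟨h2, fun s => ?_⟩
      have := Finset.single_le_sum (f := w) (fun _ _ => Nat.zero_le _) (Finset.mem_univ (s : Fin n))
      omega
    · intro w hw w' hw' h
      simp only [Prod.mk.injEq] at h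
      obtain ⟨h1, h2⟩ := h
      have h3 : ∀ s ∈ T, w s = w' s := fun s hs => congrFun h2 ⟨s, hs⟩
      have e : ∀ v : Fin n → ℕ, (∑ r, v r) = (∑ r ∈ T, v r) + (v a + v b) := by
        intro v
        rw [← Finset.sum_sdiff (Finset.subset_univ {a, b}), Finset.sum_pair hab]
      have e1 := e w
      have e2 := e w'
      have e3 : (∑ r ∈ T, w r) = ∑ r ∈ T, w' r := Finset.sum_congr rfl h3
      rw [(hS w hw).1] at e1
      rw [(hS w' hw').1] at e2
      obtain ⟨p, q⟩ := hg w hw w' hw' h1 (by omega)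
      funext s
      by_cases hsa : s = a
      · rw [hsa]; exact p
      by_cases hsb : s = b
      · rw [hsb]; exact q
      exact h3 s (by simp [hT, hsa, hsb])
  rw [Finset.card_product, Finset.card_range, Fintype.card_piFinset] at key
  simpa [hcard] using key

lemma aux_cover {n : ℕ} (l : Fin n → ℤ) (d : ℕ) (w : Fin n → ℕ)
    (h : w ∈ Wfrak l d) (h' : w ∉ Wprime l d) :
    (∃ r, w r < d) ∨ ∃ a b : Fin n, a ≠ b ∧ w b ≤ w a + 4 * Lnorm l ∧
      w a ≤ w b + 4 * Lnorm l := by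
  by_contra hc
  push Not at hc
  obtain ⟨h1, h2⟩ := hc
  obtain ⟨i, ⟨hi, hm⟩, t, ht, hw, -⟩ := h
  have hadj : ∀ a b : Fin n, a < b → w a + 4 * Lnorm l < w b := by
    intro a b hab
    by_contra hcon
    have := h2 a b hab.ne (by omega)
    have := hm hab
    have := ht a
    have := ht b
    have := hw a
    have := hw b
    omega
  apply h'
  refine ⟨⟨h1, fun a b hab => ?_⟩, fun a b hab => hadj a b (by rw [Fin.lt_def]; omega)⟩
  have := hadj a b hab
  omega

/-- There exists `C₁ > 0` such that for all sufficiently large `k`,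
`𝔚_{(k,n)} − W′_{(k,n)} ≤ C₁·k^(n−2)`, where `A_{(k,n)} = #{i ∈ A : |i| = k}`. -/
theorem statement13 {n : ℕ} (hn : 2 ≤ n) (l : Fin n → ℤ) (d : ℕ) (hd : 1 ≤ d) :
    ∃ C₁ : ℝ, 0 < C₁ ∧ ∀ᶠ k : ℕ in Filter.atTop,
      (Set.ncard {i : Fin n → ℕ | i ∈ Wfrak l d ∧ (∑ a, i a) = k} : ℝ) -
        (Set.ncard {i : Fin n → ℕ | i ∈ Wprime l d ∧ (∑ a, i a) = k} : ℝ) ≤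
      C₁ * (k : ℝ) ^ (n - 2) := by
  classical
  set L := Lnorm l with hL
  refine ⟨((n * n * ((d + (8 * L + 1)) * 2 ^ (n - 2)) : ℕ) : ℝ), ?_, ?_⟩
  · have : 0 < n := by omega
    exact_mod_cast (by positivity)
  filter_upwards [Filter.eventually_ge_atTop 1] with k hk
  set A := {i : Fin n → ℕ | i ∈ Wfrak l d ∧ (∑ a, i a) = k} with hA
  set B := {i : Fin n → ℕ | i ∈ Wprime l d ∧ (∑ a, i a) = k} with hB
  set U : Finset (Fin n → ℕ) := Fintype.piFinset (fun _ => Finset.range (k + 1)) with hU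
  have hmemU : ∀ w : Fin n → ℕ, (∑ a, w a) = k → w ∈ U := by
    intro w hw
    rw [hU, Fintype.mem_piFinset]
    intro s
    have := Finset.single_le_sum (f := w) (fun _ _ => Nat.zero_le _) (Finset.mem_univ s)
    rw [Finset.mem_range]; omega
  have hBf : B.Finite := U.finite_toSet.subset fun w hw => hmemU w hw.2
  let S1 : Fin n × Fin n → Finset (Fin n → ℕ) := fun p =>
    U.filter fun w => p.1 ≠ p.2 ∧ (∑ a, w a) = k ∧ w p.1 < d
  let S2 : Fin n × Fin n → Finset (Fin n → ℕ) := fun p =>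
    U.filter fun w => p.1 ≠ p.2 ∧ (∑ a, w a) = k ∧ w p.2 ≤ w p.1 + 4 * L ∧ w p.1 ≤ w p.2 + 4 * L
  have c1 : ∀ p, (S1 p).card ≤ d * (k + 1) ^ (n - 2) := by
    intro p
    by_cases hp : p.1 = p.2
    · simp [S1, hp]
    apply aux_count p.1 p.2 hp k d (fun x _ => x)
    · intro w hw
      simp only [S1, Finset.mem_filter] at hw
      exact hw.2.2
    · intro w _ w' _ h1 h2
      omega
  have c2 : ∀ p, (S2 p).card ≤ (8 * L + 1) * (k + 1) ^ (n - 2) := by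
    intro p
    by_cases hp : p.1 = p.2
    · simp [S2, hp]
    apply aux_count p.1 p.2 hp k (8 * L + 1) (fun x y => y + 4 * L - x)
    · intro w hw
      simp only [S2, Finset.mem_filter] at hw
      exact ⟨hw.2.2.1, by omega⟩
    · intro w hw w' hw' h1 h2
      simp only [S2, Finset.mem_filter] at hw hw'
      omega
  have hsub : A \ B ⊆ ((Finset.univ.biUnion fun p => S1 p ∪ S2 p : Finset (Fin n → ℕ)) :
      Set (Fin n → ℕ)) := by
    rintro w ⟨⟨hw, hk'⟩, hwB⟩
    have hw' : w ∉ Wprime l d := fun h => hwB ⟨h, hk'⟩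
    have hu := hmemU w hk'
    simp only [Finset.mem_coe, Finset.mem_biUnion, Finset.mem_union, S1, S2, Finset.mem_filter]
    rcases aux_cover l d w hw hw' with ⟨r, hr⟩ | ⟨a, b, hab, h1, h2⟩
    · have : Nontrivial (Fin n) := Fin.nontrivial_iff_two_le.2 hn
      obtain ⟨b, hb⟩ := exists_ne r
      exact ⟨(r, b), Finset.mem_univ _, Or.inl ⟨hu, hb.symm, hk', hr⟩⟩
    · exact ⟨(a, b), Finset.mem_univ _, Or.inr ⟨hu, hab, hk', h1, h2⟩⟩
  have hle : (A \ B).ncard ≤ n * n * ((d + (8 * L + 1)) * (k + 1) ^ (n - 2)) := by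
    refine (Set.ncard_le_ncard hsub (Finset.finite_toSet _)).trans ?_
    rw [Set.ncard_coe_finset]
    refine (Finset.card_biUnion_le_card_mul _ _ ((d + (8 * L + 1)) * (k + 1) ^ (n - 2)) ?_).trans ?_
    · intro p _
      refine (Finset.card_union_le _ _).trans ?_
      rw [add_mul]
      exact add_le_add (c1 p) (c2 p)
    · simp
  have hdiff : A.ncard ≤ (A \ B).ncard + B.ncard := Set.ncard_le_ncard_sdiff_add_ncard A B hBf
  have hpow : (k + 1) ^ (n - 2) ≤ 2 ^ (n - 2) * k ^ (n - 2) := by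
    rw [← mul_pow]; exact Nat.pow_le_pow_left (by omega) _
  have hfin : A.ncard ≤ n * n * ((d + (8 * L + 1)) * 2 ^ (n - 2)) * k ^ (n - 2) + B.ncard := by
    refine hdiff.trans (Nat.add_le_add_right (hle.trans ?_) _)
    calc _ ≤ n * n * ((d + (8 * L + 1)) * (2 ^ (n - 2) * k ^ (n - 2))) := by gcongr
      _ = _ := by ring
  rw [sub_le_iff_le_add]
  exact_mod_cast hfin
end

section
/- Suppose l₁,…,lₙ are not all equal. Then there exists a constant M > 0 such that for all sufficiently large integers k, the set 𝒜_k = {i ∈ 𝔚 : |i| = k and #ℛ_i < 𝓜} has cardinality at most M·k^{n−2}. -/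
/-- `e_m`, `m ∈ ℤ`: the standard basis vector of the free real vector space on `ℕ`,
viewed inside its exterior algebra, with the convention `e_m = 0` for `m < 0`. -/
noncomputable def evec (m : ℤ) : ExteriorAlgebra ℝ (ℕ →₀ ℝ) :=
  if 0 ≤ m then ExteriorAlgebra.ι ℝ (Finsupp.single m.toNat (1 : ℝ)) else 0

/-- `e_{a₁} ∧ ⋯ ∧ e_{aₙ}`: the product `ι(e_{a₁})⋯ι(e_{aₙ})` in the exterior algebra. -/
noncomputable def wedge {n : ℕ} (idx : Fin n → ℤ) : ExteriorAlgebra ℝ (ℕ →₀ ℝ) :=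
  (List.ofFn fun r => evec (idx r)).prod

/-- `ℛ_i = {j ∈ ℕⁿ : d ≤ j₁ < ⋯ < jₙ, ∃ π ∈ Σₙ,
`e_{j₁+l_{π(1)}} ∧ ⋯ ∧ e_{jₙ+l_{π(n)}} = e_{i₁} ∧ ⋯ ∧ e_{iₙ}}`. -/
def Rcal {n : ℕ} (l : Fin n → ℤ) (d : ℕ) (i : Fin n → ℕ) : Set (Fin n → ℕ) :=
  {j | j ∈ Wset n d ∧ ∃ π : Equiv.Perm (Fin n),
        wedge (fun r => (j r : ℤ) + l (π r)) = wedge (fun r => (i r : ℤ))}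

theorem wedge_ne_zero {n : ℕ} (i : Fin n → ℕ) (hi : Function.Injective i) :
    wedge (fun r => (i r : ℤ)) ≠ 0 := by
  let p : (ℕ →₀ ℝ) →ₗ[ℝ] (Fin n → ℝ) := LinearMap.pi fun r => Finsupp.lapply (i r)
  let D : (ℕ →₀ ℝ) [⋀^Fin n]→ₗ[ℝ] ℝ :=
    (Matrix.detRowAlternating (R := ℝ) (n := Fin n)).compLinearMap p
  let F : ∀ m, (ℕ →₀ ℝ) [⋀^Fin m]→ₗ[ℝ] ℝ := fun m =>
    if h : n = m then h ▸ D else 0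
  have hw : wedge (fun r => (i r : ℤ)) =
      ExteriorAlgebra.ιMulti ℝ n (fun r => Finsupp.single (i r) (1 : ℝ)) := by
    rw [ExteriorAlgebra.ιMulti_apply]
    simp [wedge, evec]
  intro h0
  rw [hw] at h0
  have h1 := congrArg (ExteriorAlgebra.liftAlternating F) h0
  rw [ExteriorAlgebra.liftAlternating_apply_ιMulti, map_zero] at h1
  have h2 : F n = D := by simp [F]
  rw [h2] at h1
  have h3 : (fun r => p (Finsupp.single (i r) (1 : ℝ))) = (1 : Matrix (Fin n) (Fin n) ℝ) := by
    ext a b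
    simp [p, Finsupp.single_apply, Matrix.one_apply, hi.eq_iff]
  have h4 : D (fun r => Finsupp.single (i r) (1 : ℝ)) = Matrix.det (1 : Matrix (Fin n) (Fin n) ℝ) := by
    rw [← h3]; rfl
  rw [h4, Matrix.det_one] at h1
  exact one_ne_zero h1

theorem wedge_mem {n : ℕ} (i : Fin n → ℕ) (hi : Function.Injective i) (a : Fin n → ℤ)
    (h : wedge a = wedge (fun r => (i r : ℤ))) (r : Fin n) : ∃ s, a r = i s := by
  by_contra hc
  push Not at hc
  let f : (ℕ →₀ ℝ) →ₗ[ℝ] (ℕ →₀ ℝ) :=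
    Finsupp.lsum ℝ fun m => if (m : ℤ) = a r then 0 else Finsupp.lsingle m
  have hf : ∀ m : ℕ, f (Finsupp.single m 1) = if (m : ℤ) = a r then 0 else Finsupp.single m 1 := by
    intro m
    simp only [f, Finsupp.lsum_single]
    split_ifs <;> simp
  have h1 : ExteriorAlgebra.map f (wedge a) = 0 := by
    rw [wedge, map_list_prod, List.map_ofFn]
    apply List.prod_eq_zero
    rw [List.mem_ofFn]
    refine ⟨r, ?_⟩
    simp only [Function.comp, evec]
    split_ifs with h0
    · rw [ExteriorAlgebra.map_apply_ι, hf, if_pos (Int.toNat_of_nonneg h0), map_zero]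
    · simp
  have h2 : ExteriorAlgebra.map f (wedge (fun r => (i r : ℤ))) = wedge (fun r => (i r : ℤ)) := by
    rw [wedge, map_list_prod, List.map_ofFn]
    congr 2
    funext s
    simp only [Function.comp, evec]
    rw [if_pos (Int.natCast_nonneg _), ExteriorAlgebra.map_apply_ι, hf, if_neg]
    simpa using (hc s).symm
  rw [h, h2] at h1
  exact wedge_ne_zero i hi h1

theorem natAbs_le_Lnorm {n : ℕ} (l : Fin n → ℤ) (a : Fin n) : (l a).natAbs ≤ Lnorm l :=
  Finset.single_le_sum (f := fun a => (l a).natAbs) (fun _ _ => Nat.zero_le _) (Finset.mem_univ a)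

theorem Rcal_finite {n : ℕ} (l : Fin n → ℤ) (d : ℕ) (i : Fin n → ℕ) (hi : Function.Injective i) :
    (Rcal l d i).Finite := by
  apply (Set.finite_Iic (fun _ : Fin n => ∑ a, i a + Lnorm l)).subset
  rintro j ⟨-, π, h⟩ r
  obtain ⟨s, hs⟩ := wedge_mem i hi _ h r
  have h1 := natAbs_le_Lnorm l (π r)
  have h2 : i s ≤ ∑ a, i a := Finset.single_le_sum (fun _ _ => Nat.zero_le _) (Finset.mem_univ s)
  simp only at hs ⊢
  omega

theorem good {n : ℕ} (l : Fin n → ℤ) (d : ℕ) (i : Fin n → ℕ) (hW : i ∈ Wfrak l d)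
    (h1 : ∀ r, d + Lnorm l ≤ i r)
    (h2 : ∀ r s, r ≠ s → ¬ (i s ≤ i r ∧ i r ≤ i s + 2 * Lnorm l)) :
    Mcount l ≤ Set.ncard (Rcal l d i) := by
  classical
  obtain ⟨w, hw, t, ht, hwt, hinj⟩ := hW
  have hi : Function.Injective i := by
    intro a b hab
    apply hinj
    simp only [← hwt, hab]
  have hmono : ∀ r s, r < s → i r + 2 * Lnorm l < i s := by
    intro r s hrs
    have := hw.2 hrs
    have a1 := h2 r s hrs.ne
    have a2 := h2 s r hrs.ne'
    have := ht r
    have := ht s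
    have := hwt r
    have := hwt s
    omega
  have key : Mcount l = ((Finset.univ.image fun π : Equiv.Perm (Fin n) => l ∘ π).image
      (fun (m : Fin n → ℤ) (r : Fin n) => ((i r : ℤ) - m r).toNat)).card := by
    rw [Finset.card_image_of_injOn]
    · unfold Mcount
      congr!
    · intro m hm m' hm' h
      simp only [Finset.coe_image, Finset.coe_univ, Set.image_univ, Set.mem_range] at hm hm'
      obtain ⟨π, rfl⟩ := hm
      obtain ⟨π', rfl⟩ := hm'
      funext r
      have h := congrFun h r
      have := natAbs_le_Lnorm l (π r)
      have := natAbs_le_Lnorm l (π' r)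
      have := h1 r
      simp only [Function.comp] at h ⊢
      omega
  rw [key, ← Set.ncard_coe_finset]
  apply Set.ncard_le_ncard _ (Rcal_finite l d i hi)
  intro j hj
  simp only [Finset.coe_image, Finset.coe_univ, Set.image_univ, Set.mem_image, Set.mem_range] at hj
  obtain ⟨_, ⟨π, rfl⟩, rfl⟩ := hj
  refine ⟨⟨?_, ?_⟩, π, ?_⟩
  · intro r
    have := natAbs_le_Lnorm l (π r)
    have := h1 r
    simp only [Function.comp]
    omega
  · intro r s hrs
    have := natAbs_le_Lnorm l (π r)
    have := natAbs_le_Lnorm l (π s)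
    have := h1 r
    have := h1 s
    have := hmono r s hrs
    simp only [Function.comp]
    omega
  · congr 1
    funext r
    have := natAbs_le_Lnorm l (π r)
    have := h1 r
    simp only [Function.comp]
    omega

theorem count_le {n : ℕ} (k : ℕ) (r s : Fin n) (hrs : r ≠ s) (S : Set (Fin n → ℕ))
    (hS : ∀ i ∈ S, ∑ a, i a = k)
    (hd : ∀ i ∈ S, ∀ j ∈ S, i r + i s = j r + j s → i r = j r) :
    S.Finite ∧ S.ncard ≤ (k + 1) ^ (n - 2) := by
  classical
  let T : Finset ({x : Fin n // x ∉ ({r, s} : Finset (Fin n))} → ℕ) :=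
    Fintype.piFinset fun _ => Finset.range (k + 1)
  let g : (Fin n → ℕ) → ({x : Fin n // x ∉ ({r, s} : Finset (Fin n))} → ℕ) := fun i x => i x
  have hmaps : Set.MapsTo g S T := by
    intro i hi
    simp only [T, g, Finset.mem_coe, Fintype.mem_piFinset, Finset.mem_range]
    intro x
    have : i x ≤ ∑ a, i a := Finset.single_le_sum (fun _ _ => Nat.zero_le _) (Finset.mem_univ x.1)
    have := hS i hi
    omega
  have hinj : Set.InjOn g S := by
    intro i hi j hj hij
    have hx : ∀ x, x ∉ ({r, s} : Finset (Fin n)) → i x = j x := fun x hx => congrFun hij ⟨x, hx⟩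
    have e1 := Finset.sum_add_sum_compl ({r, s} : Finset (Fin n)) i
    have e2 := Finset.sum_add_sum_compl ({r, s} : Finset (Fin n)) j
    have e3 : ∑ x ∈ ({r, s} : Finset (Fin n))ᶜ, i x = ∑ x ∈ ({r, s} : Finset (Fin n))ᶜ, j x :=
      Finset.sum_congr rfl fun x h => hx x (Finset.mem_compl.1 h)
    rw [Finset.sum_pair hrs] at e1 e2
    have := hS i hi
    have := hS j hj
    have e4 : i r + i s = j r + j s := by omega
    have e5 := hd i hi j hj e4
    funext x
    by_cases h : x ∈ ({r, s} : Finset (Fin n))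
    · simp only [Finset.mem_insert, Finset.mem_singleton] at h
      rcases h with rfl | rfl
      · exact e5
      · omega
    · exact hx x h
  refine ⟨Set.Finite.of_injOn hmaps hinj T.finite_toSet, ?_⟩
  have := Set.ncard_le_ncard_of_injOn g hmaps hinj T.finite_toSet
  rw [Set.ncard_coe_finset] at this
  refine this.trans (le_of_eq ?_)
  simp only [T, Fintype.card_piFinset, Finset.card_range, Finset.prod_const, Finset.card_univ]
  congr 1
  rw [Fintype.card_subtype_compl]
  rw [Fintype.card_coe, Finset.card_pair hrs, Fintype.card_fin]

/-- Suppose `l₁,…,lₙ` are not all equal.  Then there is `M > 0` such that for all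
sufficiently large `k`, `𝒜_k = {i ∈ 𝔚 : |i| = k, #ℛ_i < 𝓜}` has cardinality at most
`M·k^(n−2)`. -/
theorem statement15 {n : ℕ} (hn : 2 ≤ n) (l : Fin n → ℤ)
    (hl : ¬ ∀ a b : Fin n, l a = l b) (d : ℕ) (hd : 1 ≤ d) :
    ∃ M : ℝ, 0 < M ∧ ∀ᶠ k : ℕ in Filter.atTop,
      (Set.ncard {i : Fin n → ℕ | i ∈ Wfrak l d ∧ (∑ a, i a) = k ∧
          Set.ncard (Rcal l d i) < Mcount l} : ℝ) ≤ M * (k : ℝ) ^ (n - 2) := by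
  classical
  let C := 2 * Lnorm l + d + 1
  let S : ℕ → (Fin n × Fin n × Fin C × Bool) → Set (Fin n → ℕ) := fun k p =>
    {i | p.1 ≠ p.2.1 ∧ ∑ a, i a = k ∧
      if p.2.2.2 then i p.1 = i p.2.1 + p.2.2.1 else i p.1 = p.2.2.1}
  have hScount : ∀ k p, (S k p).Finite ∧ (S k p).ncard ≤ (k + 1) ^ (n - 2) := by
    rintro k ⟨r, s, c, b⟩
    by_cases hrs : r = s
    · have : S k (r, s, c, b) = ∅ := by
        ext i
        simp [S, hrs]
      rw [this]
      simp
    · apply count_le k r s hrs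
      · rintro i ⟨-, h, -⟩
        exact h
      · rintro i ⟨-, -, h⟩ j ⟨-, -, h'⟩ e
        cases b <;> simp at h h' <;> omega
  refine ⟨(Fintype.card (Fin n × Fin n × Fin C × Bool) + 1) * 2 ^ (n - 2), by positivity, ?_⟩
  filter_upwards [Filter.eventually_ge_atTop 1] with k hk
  have hsub : {i : Fin n → ℕ | i ∈ Wfrak l d ∧ (∑ a, i a) = k ∧
          Set.ncard (Rcal l d i) < Mcount l} ⊆ ⋃ p, S k p := by
    rintro i ⟨hW, hk, hlt⟩
    by_contra hc
    simp only [Set.mem_iUnion, not_exists] at hc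
    refine absurd (good l d i hW ?_ ?_) (not_le.2 hlt)
    · intro r
      by_contra hr
      have : Nontrivial (Fin n) := Fin.nontrivial_iff_two_le.2 hn
      obtain ⟨s, hs⟩ := exists_ne r
      exact hc (r, s, ⟨i r, by omega⟩, false) ⟨hs.symm, hk, by simp⟩
    · rintro r s hrs ⟨h1, h2⟩
      refine hc (r, s, ⟨i r - i s, by omega⟩, true) ⟨hrs, hk, ?_⟩
      simp
      omega
  have hfin : (⋃ p, S k p).Finite := Set.finite_iUnion fun p => (hScount k p).1
  have hle := (Set.ncard_le_ncard hsub hfin).trans (Set.ncard_iUnion_le_of_fintype (S k))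
  have hle2 := hle.trans (Finset.sum_le_card_nsmul _ _ _ fun p _ => (hScount k p).2)
  rw [smul_eq_mul, Finset.card_univ] at hle2
  have hle3 : ((Set.ncard {i : Fin n → ℕ | i ∈ Wfrak l d ∧ (∑ a, i a) = k ∧
          Set.ncard (Rcal l d i) < Mcount l} : ℕ) : ℝ) ≤
      (Fintype.card (Fin n × Fin n × Fin C × Bool) : ℝ) * ((k : ℝ) + 1) ^ (n - 2) := by
    exact_mod_cast hle2
  have hk' : (1 : ℝ) ≤ k := by exact_mod_cast hk
  calc _ ≤ _ := hle3
    _ ≤ ((Fintype.card (Fin n × Fin n × Fin C × Bool) : ℝ) + 1) * (2 * (k : ℝ)) ^ (n - 2) := by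
      gcongr <;> linarith
    _ = _ := by rw [mul_pow]; ring
end

section
/- Let α = (α_i)_{i≥0} be a complex weight that is regular with limit 1 and fix 0 < ε < 1. Then there exists a constant C > 0 such that for all sufficiently large integers k, #𝒜̌_{k+S_𝔩,𝓜,ε} ≤ C·k^{n−2}. -/
/-- `𝓔_{r,m} = {j ∈ 𝔚 : |j| = r, #ℛ_j = m}` (empty for `r < 0`). -/
def Ecal {n : ℕ} (l : Fin n → ℤ) (d : ℕ) (r : ℤ) (m : ℕ) : Set (Fin n → ℕ) :=
  {j | j ∈ Wfrak l d ∧ (∑ a, (j a : ℤ)) = r ∧ Set.ncard (Rcal l d j) = m}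

/-- `𝒜̃_{k+S_𝔩,𝓜,ε} = {j ∈ 𝓔_{k+S_𝔩,𝓜} : Γ_{j_m,−l_{π(m)}} > 1−ε for all m, π}`. -/
def AtildeCal {n : ℕ} (l : Fin n → ℤ) (d : ℕ) (α : ℕ → ℂ) (ε : ℝ) (k : ℤ) :
    Set (Fin n → ℕ) :=
  {j | j ∈ Ecal l d (k + ∑ a, l a) (Mcount l) ∧
        ∀ (m : Fin n) (π : Equiv.Perm (Fin n)), 1 - ε < Gamma α (j m) (- l (π m))}

theorem aux_Gamma (α : ℕ → ℂ) (ε : ℝ) (hε0 : 0 < ε) (N L : ℕ)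
    (hN : ∀ i, N ≤ i → 1 - ε < ‖α i‖) (i : ℕ) (t : ℤ) (ht : t.natAbs ≤ L)
    (hi : N + L + 1 ≤ i) : 1 - ε < Gamma α i t := by
  unfold Gamma
  by_cases h0 : t = 0
  · rw [if_pos h0]
    linarith
  · rw [if_neg h0]
    set T : Set ℝ := {x : ℝ | ∃ s : ℕ, s < t.natAbs ∧
      x = ‖alphaE α (if 0 < t then (i : ℤ) + s else (i : ℤ) - 1 - s)‖} with hT
    have hfin : T.Finite := by
      have : T ⊆ (fun s : ℕ => ‖alphaE α (if 0 < t then (i : ℤ) + s else (i : ℤ) - 1 - s)‖) ''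
          (Set.Iio t.natAbs) := by
        rintro x ⟨s, hs, rfl⟩
        exact ⟨s, hs, rfl⟩
      exact ((Set.finite_Iio _).image _).subset this
    have hne : T.Nonempty := ⟨_, 0, by omega, rfl⟩
    obtain ⟨s, hs, hx⟩ := hne.csInf_mem hfin
    rw [hx]
    have key : ∀ z : ℤ, (N : ℤ) ≤ z → 1 - ε < ‖alphaE α z‖ := by
      intro z hz
      unfold alphaE
      rw [if_pos (by omega)]
      exact hN _ (by omega)
    apply key
    split_ifs <;> omega

theorem aux_count_s16 {n : ℕ} (hn : 2 ≤ n) (D : Set (Fin n → ℕ)) (B K : ℕ) (R : ℤ)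
    (hsum : ∀ j ∈ D, ∑ a, (j a : ℤ) = R) (hle : ∀ j ∈ D, ∀ a, j a < K)
    (hsm : ∀ j ∈ D, ∃ m, j m < B) :
    D.ncard ≤ n * (B * K ^ (n - 2)) := by
  classical
  have : ∀ m : Fin n, ∃ m' : Fin n, m' ≠ m := by
    intro m
    haveI : Nontrivial (Fin n) := Fin.nontrivial_iff_two_le.mpr hn
    exact exists_ne m
  choose q hq using this
  have : ∀ j : Fin n → ℕ, ∃ m : Fin n, j ∈ D → j m < B := by
    intro j
    by_cases h : j ∈ D
    · obtain ⟨m, hm⟩ := hsm j h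
      exact ⟨m, fun _ => hm⟩
    · exact ⟨⟨0, by omega⟩, fun h' => absurd h' h⟩
  choose p hp using this
  let T : Fin n → Fin n → Finset ℕ := fun m r =>
    if r = m then Finset.range B else if r = q m then {0} else Finset.range K
  let F : Finset (Σ _ : Fin n, (Fin n → ℕ)) :=
    Finset.univ.sigma fun m => Fintype.piFinset (T m)
  have hcard : ∀ m, (Fintype.piFinset (T m)).card = B * K ^ (n - 2) := by
    intro m
    rw [Fintype.card_piFinset, ← Finset.mul_prod_erase _ _ (Finset.mem_univ m),
      ← Finset.mul_prod_erase _ _ (Finset.mem_erase.mpr ⟨hq m, Finset.mem_univ (q m)⟩)]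
    have h1 : (T m m).card = B := by simp [T]
    have h2 : (T m (q m)).card = 1 := by simp [T, hq m]
    rw [h1, h2, one_mul]
    congr 1
    rw [Finset.prod_congr rfl (g := fun _ => K), Finset.prod_const,
      Finset.card_erase_of_mem (Finset.mem_erase.mpr ⟨hq m, Finset.mem_univ (q m)⟩),
      Finset.card_erase_of_mem (Finset.mem_univ m), Finset.card_univ, Fintype.card_fin]
    · rfl
    · intro x hx
      simp only [Finset.mem_erase, Finset.mem_univ, and_true] at hx
      simp [T, hx.1, hx.2]
  have hF : F.card = n * (B * K ^ (n - 2)) := by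
    simp [F, Finset.card_sigma, hcard]
  rw [← hF, ← Set.ncard_coe_finset F]
  refine Set.ncard_le_ncard_of_injOn
    (fun j => (⟨p j, Function.update j (q (p j)) 0⟩ : Σ _ : Fin n, (Fin n → ℕ))) ?_ ?_
    (Finset.finite_toSet _)
  · intro j hj
    simp only [F, Finset.mem_coe, Finset.mem_sigma, Finset.mem_univ, true_and,
      Fintype.mem_piFinset]
    intro r
    by_cases h1 : r = p j
    · subst h1
      simp [T, Function.update_of_ne (hq (p j)).symm, hp j hj]
    · by_cases h2 : r = q (p j)
      · simp [T, h2, hq]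
      · simp [T, h1, h2, hle j hj r]
  · intro j hj j' hj' h
    simp only [Sigma.mk.injEq, heq_eq_eq] at h
    obtain ⟨h1, h2⟩ := h
    rw [← h1] at h2
    have hoff : ∀ r, r ≠ q (p j) → j r = j' r := by
      intro r hr
      have := congrFun h2 r
      simpa [hr] using this
    funext r
    by_cases hr : r = q (p j)
    · subst hr
      have e := (hsum j hj).trans (hsum j' hj').symm
      rw [← Finset.add_sum_erase _ _ (Finset.mem_univ (q (p j))),
        ← Finset.add_sum_erase (a := q (p j)) _ (fun a => (j' a : ℤ)) (Finset.mem_univ _),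
        Finset.sum_congr rfl (g := fun a => (j' a : ℤ))] at e
      · omega
      · intro x hx
        rw [hoff x (Finset.ne_of_mem_erase hx)]
    · exact hoff r hr

/-- If the weight `α` is regular with limit `1` and `0 < ε < 1`, then there is `C > 0`
such that for all sufficiently large `k`, `#𝒜̌_{k+S_𝔩,𝓜,ε} ≤ C·k^(n−2)`, where
`𝒜̌_{k+S_𝔩,𝓜,ε} = 𝓔_{k+S_𝔩,𝓜} ∖ 𝒜̃_{k+S_𝔩,𝓜,ε}`. -/
theorem statement16 {n : ℕ} (hn : 2 ≤ n) (l : Fin n → ℤ) (d : ℕ) (hd : 1 ≤ d)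
    (α : ℕ → ℂ)
    (hlim : Filter.Tendsto (fun i => ‖α i‖) Filter.atTop (nhds 1))
    (hbd : ∀ m : ℕ, ‖α m‖ ≤ 1)
    (ε : ℝ) (hε0 : 0 < ε) (hε1 : ε < 1) :
    ∃ C : ℝ, 0 < C ∧ ∀ᶠ k : ℕ in Filter.atTop,
      (Set.ncard (Ecal l d ((k : ℤ) + ∑ a, l a) (Mcount l) \ AtildeCal l d α ε (k : ℤ)) : ℝ) ≤
        C * (k : ℝ) ^ (n - 2) := by
  have hev : ∀ᶠ i in Filter.atTop, 1 - ε < ‖α i‖ :=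
    hlim.eventually (lt_mem_nhds (by linarith))
  obtain ⟨N, hN⟩ := Filter.eventually_atTop.mp hev
  set B := N + Lnorm l + 1 with hB
  refine ⟨n * (B * 3 ^ (n - 2)), by positivity, ?_⟩
  filter_upwards [Filter.eventually_ge_atTop ((∑ a, l a).natAbs + 1)] with k hk
  have hc := aux_count_s16 hn
    (Ecal l d ((k : ℤ) + ∑ a, l a) (Mcount l) \ AtildeCal l d α ε (k : ℤ)) B (3 * k)
    ((k : ℤ) + ∑ a, l a) (fun j hj => hj.1.2.1) (by
      intro j hj a
      have h1 : (j a : ℤ) ≤ ∑ a, (j a : ℤ) :=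
        Finset.single_le_sum (f := fun a => (j a : ℤ)) (fun i _ => by positivity)
          (Finset.mem_univ a)
      rw [hj.1.2.1] at h1
      omega) (by
      intro j hj
      by_contra! hcon
      refine hj.2 ⟨hj.1, fun m π => ?_⟩
      refine aux_Gamma α ε hε0 N (Lnorm l) hN _ _ ?_ (hcon m)
      rw [Int.natAbs_neg]
      exact Finset.single_le_sum (f := fun a => (l a).natAbs) (fun i _ => Nat.zero_le _)
          (Finset.mem_univ (π m)))
  calc _ ≤ ((n * (B * (3 * k) ^ (n - 2)) : ℕ) : ℝ) := by exact_mod_cast hc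
    _ = _ := by push_cast; ring
end

section
/- Let n ≥ 1 and let x₁,…,xₙ ∈ ℓ² with coordinates x_r = (a_r(j))_{j∈ℕ}. Then (1/√(n!))·‖x₁‖·‖x₂‖⋯‖xₙ‖ ≤ ‖x₁ ⊙ x₂ ⊙ ⋯ ⊙ xₙ‖; equivalently, Σ_{(i₁,…,iₙ)∈ℕⁿ} | (1/n!) Σ_{π∈Σₙ} Π_{r=1}^n a_r(i_{π(r)}) |² ≥ (1/n!) Π_{r=1}^n Σ_{j∈ℕ} |a_r(j)|². (This answers Problem 1 of Garcia, O'Loughlin and Yu affirmatively.) -/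
open scoped ENNReal

open scoped ComplexOrder ComplexConjugate in
theorem s18_step {α : Type*} [Fintype α] [DecidableEq α] (m : ℕ) (a : α → ℂ) (F : (Fin m → α) → ℂ)
    (G : (Fin (m+1) → α) → ℂ)
    (hG : ∀ i, G i = ∑ p : Fin (m+1), a (i p) * F (fun x => i (Equiv.swap 0 p x.succ)))
    (hs : ∀ i (σ : Equiv.Perm (Fin (m+1))), G (fun x => i (σ x)) = G i) :
    ((m+1 : ℕ) : ℂ) * ((∑ q, a q * conj (a q)) * ∑ j, F j * conj (F j)) ≤ ∑ i, G i * conj (G i) := by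
  have h1 : ∑ i, G i * conj (G i)
      = ((m+1 : ℕ) : ℂ) * ∑ i : Fin (m+1) → α, a (i 0) * F (fun x => i x.succ) * conj (G i) := by
    calc ∑ i, G i * conj (G i)
        = ∑ i, ∑ p : Fin (m+1), a (i p) * F (fun x => i (Equiv.swap 0 p x.succ)) * conj (G i) := by
          refine Finset.sum_congr rfl fun i _ => ?_
          rw [← Finset.sum_mul, ← hG]
      _ = ∑ p : Fin (m+1), ∑ i : Fin (m+1) → α, a (i 0) * F (fun x => i x.succ) * conj (G i) := by
          rw [Finset.sum_comm]
          refine Finset.sum_congr rfl fun p _ => ?_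
          refine Fintype.sum_equiv ((Equiv.swap 0 p).arrowCongr (Equiv.refl α)) _ _ fun i => ?_
          have : ((Equiv.swap 0 p).arrowCongr (Equiv.refl α)) i = fun x => i (Equiv.swap 0 p x) := by
            ext x; simp [Equiv.arrowCongr]
          rw [this, hs]
          simp
      _ = _ := by simp
  rw [h1]
  have h2 : ∑ i : Fin (m+1) → α, a (i 0) * F (fun x => i x.succ) * conj (G i)
      = ∑ j : Fin m → α, ∑ q, a q * F j * conj (a q * F j + ∑ l : Fin m, a (j l) * F (Function.update j l q)) := by
    rw [← (Fin.consEquiv (fun _ => α)).sum_comp, Fintype.sum_prod_type, Finset.sum_comm]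
    refine Finset.sum_congr rfl fun j _ => Finset.sum_congr rfl fun q _ => ?_
    have e : ∀ l : Fin m, (fun x : Fin m => (Fin.cons q j : Fin (m+1) → α) (Equiv.swap 0 l.succ x.succ))
        = Function.update j l q := by
      intro l
      ext x
      by_cases h : x = l
      · subst h; simp
      · rw [Equiv.swap_apply_of_ne_of_ne (Fin.succ_ne_zero x) (by simpa using h)]
        simp [h]
    rw [hG, Fin.sum_univ_succ]
    simp only [Fin.consEquiv_apply, Fin.cons_zero, Fin.cons_succ, Equiv.swap_self, Equiv.refl_apply, e]
  rw [h2]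
  have h3 : ∑ j : Fin m → α, ∑ q, a q * F j * conj (a q * F j + ∑ l : Fin m, a (j l) * F (Function.update j l q))
     = (∑ q, a q * conj (a q)) * (∑ j, F j * conj (F j)) +
       ∑ l : Fin m, ∑ j : Fin m → α, ∑ q, a q * F j * conj (a (j l) * F (Function.update j l q)) := by
    simp only [map_add, mul_add, Finset.sum_add_distrib, map_sum, Finset.mul_sum]
    congr 1
    · simp only [Finset.sum_mul]
      refine Finset.sum_congr rfl fun j _ => Finset.sum_congr rfl fun q _ => ?_
      simp only [map_mul]; ring
    · exact (Finset.sum_congr rfl fun j _ => Finset.sum_comm).trans Finset.sum_comm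
  rw [h3]
  refine mul_le_mul_of_nonneg_left ?_ (by exact_mod_cast Nat.zero_le _)
  refine le_add_of_nonneg_right (Finset.sum_nonneg fun l _ => ?_)
  rw [← (Equiv.funSplitAt l α).symm.sum_comp, Fintype.sum_prod_type, Finset.sum_comm]
  refine Finset.sum_nonneg fun j _ => ?_
  have h4 : ∑ p, ∑ q, a q * F ((Equiv.funSplitAt l α).symm (p, j)) * conj (a ((Equiv.funSplitAt l α).symm (p, j) l) * F (Function.update ((Equiv.funSplitAt l α).symm (p, j)) l q))
      = (∑ p, conj (a p) * F ((Equiv.funSplitAt l α).symm (p, j))) *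
        star (∑ p, conj (a p) * F ((Equiv.funSplitAt l α).symm (p, j))) := by
    rw [star_sum, Finset.sum_mul_sum]
    refine Finset.sum_congr rfl fun p _ => Finset.sum_congr rfl fun q _ => ?_
    have e1 : (Equiv.funSplitAt l α).symm (p, j) l = p := by simp [Equiv.funSplitAt]
    have e2 : Function.update ((Equiv.funSplitAt l α).symm (p, j)) l q = (Equiv.funSplitAt l α).symm (q, j) := by
      ext x
      by_cases h : x = l
      · subst h; simp
      · simp [h]
    rw [e1, e2]
    simp; ring
  rw [h4]
  exact mul_star_self_nonneg _

open scoped ComplexOrder ComplexConjugate in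
theorem s18_fin {α : Type*} [Fintype α] [DecidableEq α] (n : ℕ) (a : Fin n → α → ℂ) :
    (n.factorial : ℂ) * ∏ r, ∑ q, a r q * conj (a r q) ≤
      ∑ i : Fin n → α, (∑ π : Equiv.Perm (Fin n), ∏ r, a r (i (π r))) *
        conj (∑ π : Equiv.Perm (Fin n), ∏ r, a r (i (π r))) := by
  induction n with
  | zero => simp
  | succ m ih =>
    refine le_trans ?_ (s18_step m (a 0)
      (fun j => ∑ π : Equiv.Perm (Fin m), ∏ r, a r.succ (j (π r)))
      (fun i => ∑ π : Equiv.Perm (Fin (m+1)), ∏ r, a r (i (π r))) ?_ ?_)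
    · rw [Nat.factorial_succ, Fin.prod_univ_succ]
      have := mul_le_mul_of_nonneg_left (ih (fun r => a r.succ))
        (a := ((m+1 : ℕ) : ℂ) * ∑ q, a 0 q * conj (a 0 q))
        (mul_nonneg (by exact_mod_cast Nat.zero_le _)
          (Finset.sum_nonneg fun q _ => mul_star_self_nonneg (a 0 q)))
      refine le_trans (le_of_eq ?_) (this.trans (le_of_eq ?_))
      · push_cast; ring
      · ring
    · intro i
      rw [← Equiv.Perm.decomposeFin.symm.sum_comp, Fintype.sum_prod_type]
      refine Finset.sum_congr rfl fun p _ => ?_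
      rw [Finset.mul_sum]
      refine Finset.sum_congr rfl fun e _ => ?_
      rw [Fin.prod_univ_succ]
      simp
    · intro i σ
      exact Fintype.sum_equiv (Equiv.mulLeft σ) _ _ fun π => by simp

theorem s18_real {α : Type*} [Fintype α] [DecidableEq α] (n : ℕ) (a : Fin n → α → ℂ) :
    (n.factorial : ℝ) * ∏ r, ∑ q, ‖a r q‖ ^ 2 ≤
      ∑ i : Fin n → α, ‖∑ π : Equiv.Perm (Fin n), ∏ r, a r (i (π r))‖ ^ 2 := by
  have := s18_fin n a
  simp only [Complex.mul_conj, Complex.normSq_eq_norm_sq] at this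
  open scoped ComplexOrder in exact_mod_cast this

theorem s18_trunc (n : ℕ) (a : Fin n → ℕ → ℂ) (N : ℕ) :
    (((1 / (n.factorial : NNReal)) * ∏ r, ∑ j ∈ Finset.range N, ‖a r j‖₊ ^ 2 : NNReal) : ℝ≥0∞) ≤
      ∑' i : Fin n → ℕ,
        (‖(1 / (Nat.factorial n : ℂ)) *
            ∑ π : Equiv.Perm (Fin n), ∏ r : Fin n, a r (i (π r))‖₊ : ℝ≥0∞) ^ 2 := by
  have key := s18_real n (fun r (j : Fin N) => a r j)
  have key2 : (1 / (n.factorial : NNReal)) * ∏ r, ∑ j ∈ Finset.range N, ‖a r j‖₊ ^ 2 ≤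
      ∑ i : Fin n → Fin N, ‖(1 / (Nat.factorial n : ℂ)) *
            ∑ π : Equiv.Perm (Fin n), ∏ r : Fin n, a r (i (π r))‖₊ ^ 2 := by
    rw [← NNReal.coe_le_coe]
    push_cast
    simp only [norm_mul, mul_pow, ← Finset.mul_sum, Finset.sum_range]
    have hp : (0:ℝ) < n.factorial := by exact_mod_cast n.factorial_pos
    have h5 : ‖(1 / (n.factorial : ℂ))‖ = 1 / (n.factorial : ℝ) := by simp
    rw [h5]
    calc _ = (1 / (n.factorial : ℝ))^2 * ((n.factorial : ℝ) * ∏ r, ∑ j : Fin N, ‖a r j‖ ^ 2) := by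
          field_simp
      _ ≤ _ := mul_le_mul_of_nonneg_left key (by positivity)
  refine (ENNReal.coe_le_coe.2 key2).trans ?_
  have inj : Function.Injective (fun (i : Fin n → Fin N) (r : Fin n) => ((i r : Fin N) : ℕ)) := by
    intro i j h
    ext r
    exact congrFun h r
  refine le_trans (le_of_eq ?_) (ENNReal.tsum_comp_le_tsum_of_injective inj _)
  rw [tsum_fintype]
  push_cast
  rfl



/-- Let `x₁,…,xₙ ∈ ℓ²`.  Then, in terms of the coordinates `a_r(j) = x_r(j)`, the
symmetric tensor `x₁ ⊙ ⋯ ⊙ xₙ`, realized in `ℓ²(ℕⁿ)` as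
`F(i₁,…,iₙ) = (1/n!) Σ_{π∈Σₙ} Π_r a_r(i_{π(r)})`, satisfies
`Σ_{i∈ℕⁿ} |F(i)|² ≥ (1/n!) Π_r Σ_j |a_r(j)|²`, i.e.
`(1/√(n!))·‖x₁‖⋯‖xₙ‖ ≤ ‖x₁ ⊙ ⋯ ⊙ xₙ‖`. -/
theorem statement18 (n : ℕ) (hn : 1 ≤ n) (x : Fin n → lp (fun _ : ℕ => ℂ) 2) :
    (1 / (Nat.factorial n) : ℝ≥0∞) *
        ∏ r : Fin n, ∑' j : ℕ, (‖(x r : ∀ _ : ℕ, ℂ) j‖₊ : ℝ≥0∞) ^ 2 ≤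
      ∑' i : Fin n → ℕ,
        (‖(1 / (Nat.factorial n : ℂ)) *
            ∑ π : Equiv.Perm (Fin n), ∏ r : Fin n, (x r : ∀ _ : ℕ, ℂ) (i (π r))‖₊ :
          ℝ≥0∞) ^ 2 := by
  have hsum : ∀ r, Summable fun j => ‖(x r : ∀ _ : ℕ, ℂ) j‖₊ ^ 2 := by
    intro r
    have := (lp.memℓp (x r)).summable (by norm_num)
    rw [← NNReal.summable_coe]
    simpa using this
  have hL : (1 / (Nat.factorial n) : ℝ≥0∞) *
        ∏ r : Fin n, ∑' j : ℕ, (‖(x r : ∀ _ : ℕ, ℂ) j‖₊ : ℝ≥0∞) ^ 2 =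
      (((1 / (n.factorial : NNReal)) * ∏ r, ∑' j, ‖(x r : ∀ _ : ℕ, ℂ) j‖₊ ^ 2 : NNReal) : ℝ≥0∞) := by
    have hp : (n.factorial : NNReal) ≠ 0 := by exact_mod_cast n.factorial_ne_zero
    rw [ENNReal.coe_mul, ENNReal.coe_div hp, ENNReal.coe_finset_prod]
    simp only [ENNReal.coe_tsum (hsum _)]
    push_cast
    rfl
  rw [hL]
  refine le_of_tendsto' (x := Filter.atTop) (ENNReal.tendsto_coe.2 (Filter.Tendsto.mul tendsto_const_nhds
    (tendsto_finset_prod _ fun r _ => (hsum r).hasSum.tendsto_sum_nat)))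
    (fun N => s18_trunc n (fun r => (x r : ∀ _ : ℕ, ℂ)) N)
end
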